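/- Let G be a finite simple graph on n ≥ 16 nodes and let U ∈ W₀. Then there exists a simple graph G' on n nodes such that ‖W_{G'} − U‖₁ ≤ 4‖W_G − U‖₁ and δ_□(W_{G'}, U) ≤ 50/√(log log n) (natural logarithms). -/

import Mathlib

open MeasureTheory Filter Topology
open scoped ENNReal

noncomputable section

/-- The unit interval `[0,1]` as a subset of `ℝ`. -/
def I01 : Set ℝ := Set.Icc 0 1

/-- `W₀`: symmetric measurable functions `[0,1]² → [0,1]`
(represented as functions `ℝ → ℝ → ℝ`, with the relevant values on `[0,1]²`). -/
def IsGraphon (W : ℝ → ℝ → ℝ) : Prop :=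
  Measurable (Function.uncurry W) ∧ (∀ x y, W x y = W y x) ∧
    ∀ x y, W x y ∈ Set.Icc (0 : ℝ) 1

/-- The `L¹` norm of a kernel on `[0,1]²`. -/
def l1Norm (W : ℝ → ℝ → ℝ) : ℝ :=
  ∫ x in I01, ∫ y in I01, |W x y|

/-- The cut norm of a kernel on `[0,1]²`. -/
def cutNorm (W : ℝ → ℝ → ℝ) : ℝ :=
  sSup { r : ℝ | ∃ S T : Set ℝ, MeasurableSet S ∧ MeasurableSet T ∧ S ⊆ I01 ∧ T ⊆ I01 ∧
    r = |∫ x in S, ∫ y in T, W x y| }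

/-- An invertible measure preserving map of `[0,1]`. -/
structure InvMP where
  toFun : ℝ → ℝ
  invFun : ℝ → ℝ
  maps : ∀ x ∈ I01, toFun x ∈ I01
  mapsInv : ∀ x ∈ I01, invFun x ∈ I01
  measurePreserving :
    MeasurePreserving toFun (volume.restrict I01) (volume.restrict I01)
  measurePreservingInv :
    MeasurePreserving invFun (volume.restrict I01) (volume.restrict I01)
  leftInv : ∀ x ∈ I01, invFun (toFun x) = x
  rightInv : ∀ x ∈ I01, toFun (invFun x) = x

/-- `δ_□`: the cut distance, infimum of the cut norm over invertible measure
preserving transformations of `[0,1]`. -/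
def deltaCut (U W : ℝ → ℝ → ℝ) : ℝ :=
  ⨅ φ : InvMP, cutNorm (fun x y => U x y - W (φ.toFun x) (φ.toFun y))

/-- `δ₁`: the `L¹` distance minimized over invertible measure preserving
transformations of `[0,1]`. -/
def delta1 (U W : ℝ → ℝ → ℝ) : ℝ :=
  ⨅ φ : InvMP, l1Norm (fun x y => U x y - W (φ.toFun x) (φ.toFun y))



/-- A graph property: for each `n`, a set of simple graphs on `Fin n`. -/
def GraphProp := ∀ n : ℕ, Set (SimpleGraph (Fin n))

/-- Invariance under isomorphism (isomorphic graphs necessarily have the same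
number of vertices). -/
def IsGraphProperty (P : GraphProp) : Prop :=
  ∀ (n : ℕ) (G H : SimpleGraph (Fin n)), Nonempty (G ≃g H) → (G ∈ P n ↔ H ∈ P n)

/-- The normalized edit distance between graphs on a common vertex set. -/
def graphD1 {n : ℕ} (G H : SimpleGraph (Fin n)) : ℝ :=
  (symmDiff G.edgeSet H.edgeSet).ncard / (n ^ 2 : ℝ)

/-- The edit distance from a graph to a graph property (∞ if the property
contains no graph on the same number of nodes). -/
def graphD1P {n : ℕ} (G : SimpleGraph (Fin n)) (P : GraphProp) : ℝ≥0∞ :=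
  ⨅ (H : SimpleGraph (Fin n)) (_ : H ∈ P n), ENNReal.ofReal (graphD1 G H)

open Classical in
/-- The step function `W_G` associated with a graph `G` on `{1,…,n}`:
its value on `((i−1)/n, i/n] × ((j−1)/n, j/n]` is `1` iff `ij ∈ E(G)`. -/
def graphonOf {n : ℕ} (G : SimpleGraph (Fin n)) : ℝ → ℝ → ℝ := fun x y =>
  if ∃ i j : Fin n, G.Adj i j ∧ x ∈ Set.Ioc (((i : ℕ) : ℝ) / n) ((((i : ℕ) : ℝ) + 1) / n)
      ∧ y ∈ Set.Ioc (((j : ℕ) : ℝ) / n) ((((j : ℕ) : ℝ) + 1) / n)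
  then 1 else 0

/-- `H` is (isomorphic to) an induced subgraph of `G`. -/
def IsInducedSubgraph {n k : ℕ} (G : SimpleGraph (Fin n)) (H : SimpleGraph (Fin k)) : Prop :=
  ∃ f : Fin k ↪ Fin n, ∀ i j, H.Adj i j ↔ G.Adj (f i) (f j)

/-- The subgraph of `G` induced on the vertex subset `S` has property `P`
(as a graph on `k = |S|` nodes). -/
def inducedMem {n : ℕ} (G : SimpleGraph (Fin n)) (S : Finset (Fin n)) (k : ℕ)
    (P : GraphProp) : Prop :=
  ∃ H : SimpleGraph (Fin k), H ∈ P k ∧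
    ∃ f : Fin k ↪ Fin n, (∀ i, f i ∈ S) ∧ ∀ i j, H.Adj i j ↔ G.Adj (f i) (f j)

/-- The number of `k`-element vertex subsets of `G` inducing a subgraph with property `P`. -/
def goodCount {n : ℕ} (G : SimpleGraph (Fin n)) (k : ℕ) (P : GraphProp) : ℕ :=
  {S : Finset (Fin n) | S.card = k ∧ inducedMem G S k P}.ncard

/-- Testability of a graph property (Definition 1.1 of the paper). -/
def GraphTestable (P : GraphProp) : Prop :=
  ∃ P' : GraphProp, IsGraphProperty P' ∧
    (∀ (n : ℕ) (G : SimpleGraph (Fin n)), G ∈ P n → ∀ k, 1 ≤ k → k ≤ n →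
      2 * n.choose k ≤ 3 * goodCount G k P') ∧
    (∀ ε : ℝ, 0 < ε → ∃ kε : ℕ, 1 ≤ kε ∧
      ∀ (n : ℕ) (G : SimpleGraph (Fin n)) (k : ℕ), kε ≤ k → k ≤ n →
        ENNReal.ofReal ε ≤ graphD1P G P →
        3 * goodCount G k P' ≤ n.choose k)

def cube (k : ℕ) : Set (Fin k → ℝ) := Set.univ.pi fun _ => I01

open Classical in
/-- The homomorphism density `t(F,W)`. -/
def homDensity {k : ℕ} (F : SimpleGraph (Fin k)) (W : ℝ → ℝ → ℝ) : ℝ :=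
  ∫ x in cube k, ∏ i : Fin k, ∏ j : Fin k,
    if i < j ∧ F.Adj i j then W (x i) (x j) else 1

open Classical in
/-- The induced density `t_ind(F,W)`. -/
def indDensity {k : ℕ} (F : SimpleGraph (Fin k)) (W : ℝ → ℝ → ℝ) : ℝ :=
  ∫ x in cube k, ∏ i : Fin k, ∏ j : Fin k,
    if i < j then (if F.Adj i j then W (x i) (x j) else 1 - W (x i) (x j)) else 1

/-- Isomorphism of functions in `W₀`: equality of all homomorphism densities. -/
def GraphonIso (U W : ℝ → ℝ → ℝ) : Prop :=
  ∀ (k : ℕ) (F : SimpleGraph (Fin k)), homDensity F U = homDensity F W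

open Classical in
/-- `P(G(k,W) ∈ R')`, the probability that the `W`-random graph on `k` nodes
has property `R'`. -/
def probIn (k : ℕ) (W : ℝ → ℝ → ℝ) (R' : GraphProp) : ℝ :=
  ∑ F : SimpleGraph (Fin k), if F ∈ R' k then indDensity F W else 0

/-- The `L¹` distance from `W` to a set `R` of kernels, with value `∞` for `R = ∅`. -/
def d1SetE (W : ℝ → ℝ → ℝ) (R : Set (ℝ → ℝ → ℝ)) : ℝ≥0∞ :=
  ⨅ (U : ℝ → ℝ → ℝ) (_ : U ∈ R), ENNReal.ofReal (l1Norm fun x y => W x y - U x y)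

/-- The cut-norm distance from `W` to a set `R` of kernels, with value `∞` for `R = ∅`. -/
def dCutSetE (W : ℝ → ℝ → ℝ) (R : Set (ℝ → ℝ → ℝ)) : ℝ≥0∞ :=
  ⨅ (U : ℝ → ℝ → ℝ) (_ : U ∈ R), ENNReal.ofReal (cutNorm fun x y => W x y - U x y)

/-- The open ball `B₁(R,c)` (within `W₀`). -/
def ball1 (R : Set (ℝ → ℝ → ℝ)) (c : ℝ) : Set (ℝ → ℝ → ℝ) :=
  {W | IsGraphon W ∧ d1SetE W R < ENNReal.ofReal c}

/-- The open ball `B_□(R,c)` (within `W₀`). -/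
def ballCut (R : Set (ℝ → ℝ → ℝ)) (c : ℝ) : Set (ℝ → ℝ → ℝ) :=
  {W | IsGraphon W ∧ dCutSetE W R < ENNReal.ofReal c}

/-- A graphon property: a set of graphons invariant under isomorphism. -/
def IsGraphonProperty (R : Set (ℝ → ℝ → ℝ)) : Prop :=
  (∀ W ∈ R, IsGraphon W) ∧
    ∀ U W, IsGraphon U → IsGraphon W → GraphonIso U W → (U ∈ R ↔ W ∈ R)

/-- A set of graphons is closed if it is closed in the cut norm. -/
def CutClosed (R : Set (ℝ → ℝ → ℝ)) : Prop :=
  ∀ W, IsGraphon W →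
    (∀ ε : ℝ, 0 < ε → ∃ U ∈ R, cutNorm (fun x y => W x y - U x y) < ε) → W ∈ R

/-- Testability of a graphon property. -/
def GraphonTestable (R : Set (ℝ → ℝ → ℝ)) : Prop :=
  ∃ R' : GraphProp, IsGraphProperty R' ∧
    (∀ W ∈ R, ∀ k : ℕ, 1 ≤ k → (2 : ℝ) / 3 ≤ probIn k W R') ∧
    (∀ ε : ℝ, 0 < ε → ∃ kε : ℕ, 1 ≤ kε ∧ ∀ k, kε ≤ k → ∀ W, IsGraphon W →
      ENNReal.ofReal ε ≤ d1SetE W R → probIn k W R' ≤ 1 / 3)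

/-- The closure `P̄` of a graph property: limits of convergent sequences
of graphs in `P` with sizes tending to infinity. -/
def closureP (P : GraphProp) : Set (ℝ → ℝ → ℝ) :=
  {W | IsGraphon W ∧ ∃ (n : ℕ → ℕ) (G : ∀ m, SimpleGraph (Fin (n m))),
    (∀ m, G m ∈ P (n m)) ∧ Tendsto n atTop atTop ∧
    Tendsto (fun m => deltaCut (graphonOf (G m)) W) atTop (nhds 0)}

/-- A graph property is robust if graphs whose `W_G` is `d₁`-close to `P̄`
are themselves close to `P` in edit distance. -/
def Robust (P : GraphProp) : Prop :=
  ∀ ε : ℝ, 0 < ε → ∃ (N : ℕ) (ε' : ℝ), 1 ≤ N ∧ 0 < ε' ∧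
    ∀ (n : ℕ), N ≤ n → ∀ G : SimpleGraph (Fin n),
      d1SetE (graphonOf G) (closureP P) ≤ ENNReal.ofReal ε' →
      graphD1P G P ≤ ENNReal.ofReal ε

/-- A hereditary graph property: closed under induced subgraphs. -/
def Hereditary (P : GraphProp) : Prop :=
  ∀ (n : ℕ) (G : SimpleGraph (Fin n)), G ∈ P n →
    ∀ (k : ℕ) (H : SimpleGraph (Fin k)), IsInducedSubgraph G H → H ∈ P k

/-- `U` is a flexing of `W`: `U ∈ W₀` agrees with `W` wherever `W` takes value `0` or `1`. -/
def Flexing (U W : ℝ → ℝ → ℝ) : Prop :=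
  IsGraphon U ∧ ∀ x y, (W x y = 0 ∨ W x y = 1) → U x y = W x y

/-- A function property is flexible if it is preserved under flexing. -/
def FlexibleFamily (R : Set (ℝ → ℝ → ℝ)) : Prop :=
  ∀ W ∈ R, ∀ U, Flexing U W → U ∈ R

/-- `U' ≤ W'` almost everywhere on `[0,1]²`. -/
def aeLE (U W : ℝ → ℝ → ℝ) : Prop :=
  ∀ᵐ p ∂(volume.restrict (I01 ×ˢ I01)), U p.1 p.2 ≤ W p.1 p.2

/-- `U ⪯ W`: up to isomorphism, `U ≤ W` almost everywhere. -/
def graphonLE (U W : ℝ → ℝ → ℝ) : Prop :=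
  ∃ U' W', IsGraphon U' ∧ IsGraphon W' ∧ GraphonIso U U' ∧ GraphonIso W W' ∧ aeLE U' W'

/-- The upward closure of a graph property: graphs having a spanning subgraph in `P`. -/
def upP (P : GraphProp) : GraphProp :=
  fun n => {G | ∃ H : SimpleGraph (Fin n), H ∈ P n ∧ H ≤ G}

/-- The upward closure of a function property. -/
def upR (R : Set (ℝ → ℝ → ℝ)) : Set (ℝ → ℝ → ℝ) :=
  {W | IsGraphon W ∧ ∃ U ∈ R, graphonLE U W}

/-- A stepfunction: constant on the products of a finite measurable partition of `[0,1]`. -/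
def IsStepfunction (W : ℝ → ℝ → ℝ) : Prop :=
  ∃ (m : ℕ) (S : Fin m → Set ℝ), (∀ i, MeasurableSet (S i)) ∧
    (⋃ i, S i) = I01 ∧ (∀ i j, i ≠ j → Disjoint (S i) (S j)) ∧
    ∀ i j : Fin m, ∀ x ∈ S i, ∀ x' ∈ S i, ∀ y ∈ S j, ∀ y' ∈ S j, W x y = W x' y'

open Classical in
/-- A testable graphon functional: its value can be estimated from `W`-random graphs. -/
def TestableFunctional (f : (ℝ → ℝ → ℝ) → ℝ) : Prop :=
  ∃ g : ∀ n : ℕ, SimpleGraph (Fin n) → ℝ,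
    (∀ (n : ℕ) (G H : SimpleGraph (Fin n)), Nonempty (G ≃g H) → g n G = g n H) ∧
    ∀ ε : ℝ, 0 < ε → ∃ kε : ℕ, 1 ≤ kε ∧ ∀ k, kε ≤ k → ∀ W, IsGraphon W →
      (∑ F : SimpleGraph (Fin k), if ε < |f W - g k F| then indDensity F W else 0) < 1 / 3


namespace SampleAux

def P4 {V : Type*} (H : V → V → ℝ) (q : Fin 4 → V) : ℝ :=
  H (q 0) (q 1) * H (q 2) (q 1) * H (q 0) (q 3) * H (q 2) (q 3)

def t4 {V : Type*} [Fintype V] (H : V → V → ℝ) : ℝ := ∑ q : Fin 4 → V, P4 H q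

lemma sum_fin4 {V : Type*} [Fintype V] (f : V → V → V → V → ℝ) :
    ∑ q : Fin 4 → V, f (q 0) (q 1) (q 2) (q 3) = ∑ a, ∑ b, ∑ c, ∑ d, f a b c d := by
  rw [← (Fin.consEquiv (fun _ : Fin 4 => V)).sum_comp, Fintype.sum_prod_type]
  refine Finset.sum_congr rfl fun a _ => ?_
  rw [← (Fin.consEquiv (fun _ : Fin 3 => V)).sum_comp, Fintype.sum_prod_type]
  refine Finset.sum_congr rfl fun b _ => ?_
  rw [← (finTwoArrowEquiv V).symm.sum_comp, Fintype.sum_prod_type]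
  refine Finset.sum_congr rfl fun c _ => ?_
  refine Finset.sum_congr rfl fun d _ => ?_
  rfl

lemma t4_eq {V : Type*} [Fintype V] (H : V → V → ℝ) :
    t4 H = ∑ a, ∑ b, ∑ c, ∑ d, H a b * H c b * H a d * H c d := by
  unfold t4 P4
  exact sum_fin4 (fun a b c d => H a b * H c b * H a d * H c d)

lemma t4_eq_sq {V : Type*} [Fintype V] (H : V → V → ℝ) :
    t4 H = ∑ b, ∑ d, (∑ a, H a b * H a d) ^ 2 := by
  rw [t4_eq]
  have : ∀ b d : V, (∑ a, H a b * H a d) ^ 2 = ∑ a, ∑ c, H a b * H c b * H a d * H c d := by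
    intro b d
    rw [sq, Finset.sum_mul_sum]
    refine Finset.sum_congr rfl fun a _ => Finset.sum_congr rfl fun c _ => by ring
  simp_rw [this]
  rw [Finset.sum_comm]
  refine Finset.sum_congr rfl fun b _ => ?_
  rw [Finset.sum_comm' (t' := Finset.univ) (s' := fun _ => Finset.univ) (by simp)]
  rw [Finset.sum_comm]
  rw [Finset.sum_comm]
  have : ∀ a : V, ∑ c, ∑ d, H a b * H c b * H a d * H c d
    = ∑ d, ∑ c, H a b * H c b * H a d * H c d := fun a => Finset.sum_comm
  rw [Finset.sum_comm]
  simp_rw [this]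
  rw [Finset.sum_comm]

lemma t4_nonneg {V : Type*} [Fintype V] (H : V → V → ℝ) : 0 ≤ t4 H := by
  rw [t4_eq_sq]; positivity

lemma cut_le_t4 {V : Type*} [Fintype V] (K : V → V → ℝ) (s t : V → ℝ)
    (hs : ∀ v, |s v| ≤ 1) (ht : ∀ v, |t v| ≤ 1) :
    (∑ x, ∑ y, s x * t y * K x y) ^ 4 ≤ (Fintype.card V : ℝ) ^ 4 * t4 K := by
  have hs2 : ∀ v, s v ^ 2 ≤ 1 := fun v => by
    rw [← sq_abs]; exact pow_le_one₀ (abs_nonneg _) (hs v)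
  have ht2 : ∀ v, t v ^ 2 ≤ 1 := fun v => by
    rw [← sq_abs]; exact pow_le_one₀ (abs_nonneg _) (ht v)
  set N : ℝ := (Fintype.card V : ℝ) with hNdef
  have hN : 0 ≤ N := by positivity
  have e1 : (∑ x, ∑ y, s x * t y * K x y) ^ 2 ≤ N * ∑ x, (∑ y, t y * K x y) ^ 2 := by
    have h := Finset.sum_mul_sq_le_sq_mul_sq Finset.univ s (fun x => ∑ y, t y * K x y)
    have h2 : ∑ x, ∑ y, s x * t y * K x y = ∑ x, s x * ∑ y, t y * K x y := by
      simp_rw [Finset.mul_sum, mul_assoc]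
    rw [h2]
    refine h.trans (mul_le_mul_of_nonneg_right ?_ (by positivity))
    calc ∑ i, s i ^ 2 ≤ ∑ i : V, (1 : ℝ) := Finset.sum_le_sum fun i _ => hs2 i
      _ = N := by simp [N]
  have e2 : ∑ x, (∑ y, t y * K x y) ^ 2 = ∑ y, ∑ z, (t y * t z) * (∑ x, K x y * K x z) := by
    have : ∀ x, (∑ y, t y * K x y) ^ 2 = ∑ y, ∑ z, (t y * t z) * (K x y * K x z) := by
      intro x
      rw [sq, Finset.sum_mul_sum]
      refine Finset.sum_congr rfl fun a _ => Finset.sum_congr rfl fun c _ => by ring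
    simp_rw [this, Finset.mul_sum]
    rw [Finset.sum_comm]
    refine Finset.sum_congr rfl fun a _ => ?_
    rw [Finset.sum_comm]
  have e3 : (∑ y, ∑ z, (t y * t z) * (∑ x, K x y * K x z)) ^ 2 ≤ N ^ 2 * t4 K := by
    rw [t4_eq_sq]
    have h := Finset.sum_mul_sq_le_sq_mul_sq (Finset.univ : Finset (V × V))
      (fun p => t p.1 * t p.2) (fun p => ∑ x, K x p.1 * K x p.2)
    simp only [Fintype.sum_prod_type] at h
    refine h.trans (mul_le_mul_of_nonneg_right ?_ (by positivity))
    calc ∑ y, ∑ z, (t y * t z) ^ 2 ≤ ∑ y : V, ∑ z : V, (1 : ℝ) := by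
          refine Finset.sum_le_sum fun y _ => Finset.sum_le_sum fun z _ => ?_
          rw [mul_pow]; exact mul_le_one₀ (ht2 y) (sq_nonneg _) (ht2 z)
      _ = N ^ 2 := by simp [N, sq]
  calc (∑ x, ∑ y, s x * t y * K x y) ^ 4 = ((∑ x, ∑ y, s x * t y * K x y) ^ 2) ^ 2 := by ring
    _ ≤ (N * ∑ x, (∑ y, t y * K x y) ^ 2) ^ 2 := by gcongr
    _ = N ^ 2 * (∑ y, ∑ z, (t y * t z) * (∑ x, K x y * K x z)) ^ 2 := by rw [e2]; ring
    _ ≤ N ^ 2 * (N ^ 2 * t4 K) := by gcongr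
    _ = _ := by ring

/-- The best sign vector. -/
lemma exists_sign {V : Type*} [Fintype V] (h : V → ℝ) (f : V → ℝ) (hf : ∀ v, |f v| ≤ 1) :
    ∃ b : V → Bool, |∑ x, f x * h x| ≤ ∑ x, (if b x then (1:ℝ) else -1) * h x := by
  refine ⟨fun x => decide (0 ≤ h x), ?_⟩
  refine (Finset.abs_sum_le_sum_abs _ _).trans (Finset.sum_le_sum fun x _ => ?_)
  rw [abs_mul]
  have : (if decide (0 ≤ h x) = true then (1:ℝ) else -1) * h x = |h x| := by
    by_cases h0 : 0 ≤ h x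
    · simp [h0, abs_of_nonneg]
    · simp [h0, abs_of_neg (not_le.1 h0)]
  rw [this]
  exact mul_le_of_le_one_left (abs_nonneg _) (hf x)

lemma reg_step {V : Type*} [Fintype V] (H : V → V → ℝ)
    (hb : ∀ x y, |H x y| ≤ 1) (δ : ℝ) (hδ : 0 < δ)
    (ht : δ * (Fintype.card V : ℝ) ^ 4 < t4 H) :
    ∃ f g : V → Bool, δ * (Fintype.card V : ℝ) ^ 2 ≤
      ∑ x, ∑ y, (if f x then (1:ℝ) else -1) * (if g y then (1:ℝ) else -1) * H x y := by
  set N : ℝ := (Fintype.card V : ℝ) with hNdef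
  have key : ∃ a b : V, δ * N ^ 2 ≤ |∑ c, ∑ d, H c b * (H a d * H c d)| := by
    by_contra hcon
    push Not at hcon
    have : t4 H ≤ δ * N ^ 4 := by
      rw [t4_eq]
      calc ∑ a, ∑ b, ∑ c, ∑ d, H a b * H c b * H a d * H c d
          = ∑ a, ∑ b, H a b * ∑ c, ∑ d, H c b * (H a d * H c d) := by
            simp_rw [Finset.mul_sum, mul_assoc]
        _ ≤ ∑ a : V, ∑ b : V, δ * N ^ 2 := by
            refine Finset.sum_le_sum fun a _ => Finset.sum_le_sum fun b _ => ?_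
            refine (le_abs_self _).trans ?_
            rw [abs_mul]
            exact (mul_le_of_le_one_left (abs_nonneg _) (hb a b)).trans (hcon a b).le
        _ = δ * N ^ 4 := by simp [N]; ring
    linarith
  obtain ⟨a, b, hab⟩ := key
  obtain ⟨f, hf⟩ := exists_sign (fun c => ∑ d, H a d * H c d) (fun c => H c b) (fun c => hb c b)
  obtain ⟨g, hg⟩ := exists_sign (fun d => ∑ c, (if f c then (1:ℝ) else -1) * H c d)
    (fun d => H a d) (fun d => hb a d)
  refine ⟨f, g, ?_⟩
  calc δ * N ^ 2 ≤ _ := hab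
    _ = |∑ c, H c b * ∑ d, H a d * H c d| := by simp_rw [Finset.mul_sum]
    _ ≤ _ := hf
    _ = ∑ d, H a d * ∑ c, (if f c then (1:ℝ) else -1) * H c d := by
        simp_rw [Finset.mul_sum]
        rw [Finset.sum_comm]
        refine Finset.sum_congr rfl fun d _ => Finset.sum_congr rfl fun c _ => by ring
    _ ≤ _ := (le_abs_self _).trans hg
    _ = _ := by
        simp_rw [Finset.mul_sum]
        rw [Finset.sum_comm]
        refine Finset.sum_congr rfl fun d _ => Finset.sum_congr rfl fun c _ => by ring

lemma clamp_sq (u v : ℝ) (h0 : 0 ≤ u) (h1 : u ≤ 1) :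
    (u - max 0 (min 1 v)) ^ 2 ≤ (u - v) ^ 2 := by
  rcases le_total v 0 with h | h
  · rw [min_eq_right (by linarith), max_eq_left h]; nlinarith
  rcases le_total v 1 with h' | h'
  · rw [min_eq_right h', max_eq_right h]
  · rw [min_eq_left h']; simp; nlinarith

lemma regularity_aux {V : Type*} [Fintype V] (u : V → V → ℝ)
    (usym : ∀ x y, u x y = u y x) (u01 : ∀ x y, u x y ∈ Set.Icc (0:ℝ) 1)
    (δ : ℝ) (hδ : 0 < δ) (j : ℕ) :
    (∃ (k : ℕ) (p : V → Fin k) (w : Fin k → Fin k → ℝ), k ≤ 4 ^ j ∧ (∀ a b, w a b = w b a) ∧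
      (∀ a b, w a b ∈ Set.Icc (0:ℝ) 1) ∧
      t4 (fun x y => u x y - w (p x) (p y)) ≤ δ * (Fintype.card V : ℝ) ^ 4) ∨
    (∃ (k : ℕ) (p : V → Fin k) (w : Fin k → Fin k → ℝ), k ≤ 4 ^ j ∧ (∀ a b, w a b = w b a) ∧
      (∀ a b, w a b ∈ Set.Icc (0:ℝ) 1) ∧
      ∑ x, ∑ y, (u x y - w (p x) (p y)) ^ 2 ≤ (1 - j * δ ^ 2) * (Fintype.card V : ℝ) ^ 2) := by
  induction j with
  | zero =>
    right
    refine ⟨1, fun _ => 0, fun _ _ => 0, by simp, by simp, by simp, ?_⟩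
    calc ∑ x, ∑ y, (u x y - 0) ^ 2 ≤ ∑ x : V, ∑ y : V, (1:ℝ) := by
          refine Finset.sum_le_sum fun x _ => Finset.sum_le_sum fun y _ => ?_
          have := u01 x y
          rw [sub_zero]
          exact pow_le_one₀ this.1 this.2
      _ = _ := by simp [sq]
  | succ j ih =>
    rcases ih with ⟨k, p, w, hk, h⟩ | ⟨k, p, w, hk, wsym, w01, hen⟩
    · exact Or.inl ⟨k, p, w, hk.trans (Nat.pow_le_pow_right (by norm_num) (by omega)), h⟩
    by_cases hgood : t4 (fun x y => u x y - w (p x) (p y)) ≤ δ * (Fintype.card V : ℝ) ^ 4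
    · exact Or.inl ⟨k, p, w, hk.trans (Nat.pow_le_pow_right (by norm_num) (by omega)),
        wsym, w01, hgood⟩
    right
    push Not at hgood
    set H : V → V → ℝ := fun x y => u x y - w (p x) (p y) with hH
    have Hsym : ∀ x y, H x y = H y x := fun x y => by simp only [hH]; rw [usym, wsym]
    have Hb : ∀ x y, |H x y| ≤ 1 := fun x y => by
      have h1 := u01 x y; have h2 := w01 (p x) (p y)
      simp only [Set.mem_Icc] at h1 h2
      rw [abs_le]; constructor <;> simp only [hH] <;> linarith [h1.1, h1.2, h2.1, h2.2]
    obtain ⟨f, g, hfg⟩ := reg_step H Hb δ hδ hgood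
    let σ : Bool → ℝ := fun b => if b then 1 else -1
    have σb : ∀ b, σ b = 1 ∨ σ b = -1 := fun b => by cases b <;> simp [σ]
    let κ := Fin k × Bool × Bool
    have hcard : Fintype.card κ = k * 4 := by simp [κ]
    let e : κ ≃ Fin (k * 4) := Fintype.equivFinOfCardEq hcard
    let F : κ → κ → ℝ := fun a b => (σ a.2.1 * σ b.2.2 + σ a.2.2 * σ b.2.1) / 2
    let w' : κ → κ → ℝ := fun a b => max 0 (min 1 (w a.1 b.1 + δ * F a b))
    let p' : V → κ := fun x => (p x, f x, g x)
    refine ⟨k * 4, fun x => e (p' x), fun a b => w' (e.symm a) (e.symm b), ?_, ?_, ?_, ?_⟩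
    · rw [pow_succ]; exact Nat.mul_le_mul_right 4 hk
    · intro a b; simp only [w', F]; rw [wsym]; ring_nf
    · intro a b; simp [w']
    simp only [Equiv.symm_apply_apply]
    have hFb : ∀ x y, F (p' x) (p' y) ^ 2 ≤ 1 := by
      intro x y
      simp only [F, p']
      rcases σb (f x) with h1 | h1 <;> rcases σb (f y) with h2 | h2 <;>
        rcases σb (g x) with h3 | h3 <;> rcases σb (g y) with h4 | h4 <;>
        rw [h1, h2, h3, h4] <;> norm_num
    have hHF : δ * (Fintype.card V : ℝ) ^ 2 ≤ ∑ x, ∑ y, H x y * F (p' x) (p' y) := by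
      have a1 : ∑ x, ∑ y, H x y * F (p' x) (p' y) =
          (∑ x, ∑ y, σ (f x) * σ (g y) * H x y) / 2 +
          (∑ x, ∑ y, σ (f y) * σ (g x) * H y x) / 2 := by
        simp_rw [Finset.sum_div, ← Finset.sum_add_distrib]
        refine Finset.sum_congr rfl fun x _ => Finset.sum_congr rfl fun y _ => ?_
        rw [Hsym y x]; simp only [F, p']; ring
      have a2 : ∑ x, ∑ y, σ (f y) * σ (g x) * H y x = ∑ x, ∑ y, σ (f x) * σ (g y) * H x y :=
        Finset.sum_comm
      rw [a1, a2]
      have : ∑ x, ∑ y, σ (f x) * σ (g y) * H x y = ∑ x, ∑ y, (if f x then (1:ℝ) else -1) * (if g y then (1:ℝ) else -1) * H x y := rfl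
      rw [this]; linarith
    calc ∑ x, ∑ y, (u x y - w' (p' x) (p' y)) ^ 2
        ≤ ∑ x, ∑ y, (H x y ^ 2 - 2 * δ * (H x y * F (p' x) (p' y)) + δ ^ 2) := by
          refine Finset.sum_le_sum fun x _ => Finset.sum_le_sum fun y _ => ?_
          refine (clamp_sq _ _ (u01 x y).1 (u01 x y).2).trans ?_
          have := hFb x y
          have e1 : u x y - (w (p' x).1 (p' y).1 + δ * F (p' x) (p' y)) =
            H x y - δ * F (p' x) (p' y) := by simp only [hH, p']; ring
          rw [e1]
          nlinarith [sq_nonneg δ]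
      _ = ∑ x, ∑ y, H x y ^ 2 - 2 * δ * (∑ x, ∑ y, H x y * F (p' x) (p' y))
            + δ ^ 2 * (Fintype.card V : ℝ) ^ 2 := by
          simp_rw [Finset.sum_add_distrib, Finset.sum_sub_distrib, ← Finset.mul_sum]
          simp; ring
      _ ≤ _ := by
          push_cast
          nlinarith

lemma regularity {V : Type*} [Fintype V] [Nonempty V] (u : V → V → ℝ)
    (usym : ∀ x y, u x y = u y x) (u01 : ∀ x y, u x y ∈ Set.Icc (0:ℝ) 1)
    (δ : ℝ) (hδ : 0 < δ) (m : ℕ) (hm : 1 < m * δ ^ 2) :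
    ∃ (k : ℕ) (p : V → Fin k) (w : Fin k → Fin k → ℝ), k ≤ 4 ^ m ∧ (∀ a b, w a b = w b a) ∧
      (∀ a b, w a b ∈ Set.Icc (0:ℝ) 1) ∧
      t4 (fun x y => u x y - w (p x) (p y)) ≤ δ * (Fintype.card V : ℝ) ^ 4 := by
  rcases regularity_aux u usym u01 δ hδ m with h | ⟨k, p, w, hk, _, _, h⟩
  · exact h
  exfalso
  have h1 : 0 ≤ ∑ x, ∑ y, (u x y - w (p x) (p y)) ^ 2 := by positivity
  have h2 : (0:ℝ) < (Fintype.card V : ℝ) ^ 2 := by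
    have : 0 < Fintype.card V := Fintype.card_pos
    positivity
  nlinarith

/-- A function affine in each coordinate. -/
def MAff {E : Type*} [DecidableEq E] (F : (E → ℝ) → ℝ) : Prop :=
  ∀ e c, ∃ A B : ℝ, ∀ t, F (Function.update e c t) = A + B * t

lemma MAff.add {E : Type*} [DecidableEq E] {F G : (E → ℝ) → ℝ} (hF : MAff F) (hG : MAff G) :
    MAff (fun e => F e + G e) := by
  intro e c
  obtain ⟨A, B, h⟩ := hF e c
  obtain ⟨A', B', h'⟩ := hG e c
  exact ⟨A + A', B + B', fun t => by simp only [h, h']; ring⟩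

lemma MAff.const_mul {E : Type*} [DecidableEq E] {F : (E → ℝ) → ℝ} (hF : MAff F) (a : ℝ) :
    MAff (fun e => a * F e) := by
  intro e c
  obtain ⟨A, B, h⟩ := hF e c
  exact ⟨a * A, a * B, fun t => by simp only [h]; ring⟩

lemma MAff.const {E : Type*} [DecidableEq E] (a : ℝ) : MAff (fun _ : E → ℝ => a) :=
  fun _ _ => ⟨a, 0, fun t => by ring⟩

lemma MAff.sum {E : Type*} [DecidableEq E] {I : Type*} (s : Finset I) {F : I → (E → ℝ) → ℝ}
    (hF : ∀ i ∈ s, MAff (F i)) : MAff (fun e => ∑ i ∈ s, F i e) := by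
  classical
  induction s using Finset.induction_on with
  | empty => simpa using MAff.const 0
  | insert a s ha ih =>
    simp_rw [Finset.sum_insert ha]
    exact (hF a (by simp)).add (ih fun i hi => hF i (by simp [hi]))

lemma MAff.coord {E : Type*} [DecidableEq E] (c : E) : MAff (fun e : E → ℝ => e c) := by
  intro e d
  by_cases h : c = d
  · subst h; exact ⟨0, 1, fun t => by simp⟩
  · exact ⟨e c, 0, fun t => by simp [Function.update_of_ne h]⟩

lemma MAff.exists_le {E : Type*} [DecidableEq E] [Fintype E] {F : (E → ℝ) → ℝ} (hF : MAff F)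
    (p : E → ℝ) (hp : ∀ c, p c ∈ Set.Icc (0:ℝ) 1) :
    ∃ e : E → ℝ, (∀ c, e c = 0 ∨ e c = 1) ∧ F e ≤ F p := by
  have key : ∀ s : Finset E, ∃ e : E → ℝ, (∀ c ∈ s, e c = 0 ∨ e c = 1) ∧
      (∀ c ∉ s, e c = p c) ∧ F e ≤ F p := by
    intro s
    induction s using Finset.induction_on with
    | empty => exact ⟨p, by simp, by simp, le_rfl⟩
    | insert a s ha ih =>
      obtain ⟨e, h1, h2, h3⟩ := ih
      obtain ⟨A, B, h⟩ := hF e a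
      have hea : F e = A + B * p a := by
        rw [← h, ← h2 a ha, Function.update_eq_self]
      have hpa := hp a
      have hx : ∃ t : ℝ, (t = 0 ∨ t = 1) ∧ A + B * t ≤ A + B * p a := by
        rcases le_total 0 B with hB | hB
        · exact ⟨0, Or.inl rfl, by nlinarith [hpa.1]⟩
        · exact ⟨1, Or.inr rfl, by nlinarith [hpa.2]⟩
      obtain ⟨t, ht, hle⟩ := hx
      refine ⟨Function.update e a t, ?_, ?_, ?_⟩
      · intro c hc
        by_cases hca : c = a
        · subst hca; simpa using ht
        · rw [Function.update_of_ne hca]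
          exact h1 c (by simpa [hca] using hc)
      · intro c hc
        simp only [Finset.mem_insert, not_or] at hc
        rw [Function.update_of_ne hc.1]; exact h2 c hc.2
      · rw [h]; linarith
  obtain ⟨e, h1, _, h3⟩ := key Finset.univ
  exact ⟨e, fun c => h1 c (Finset.mem_univ c), h3⟩

lemma MAff.prod4 {E : Type*} [DecidableEq E] (c1 c2 c3 c4 : E) (a1 a2 a3 a4 : ℝ)
    (h12 : c1 ≠ c2) (h13 : c1 ≠ c3) (h14 : c1 ≠ c4) (h23 : c2 ≠ c3) (h24 : c2 ≠ c4)
    (h34 : c3 ≠ c4) :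
    MAff (fun e : E → ℝ => (e c1 - a1) * (e c2 - a2) * (e c3 - a3) * (e c4 - a4)) := by
  intro e d
  by_cases d1 : d = c1
  · subst d1
    refine ⟨(-a1) * (e c2 - a2) * (e c3 - a3) * (e c4 - a4),
      (e c2 - a2) * (e c3 - a3) * (e c4 - a4), fun t => ?_⟩
    simp only [Function.update_self, Function.update_of_ne h12.symm,
      Function.update_of_ne h13.symm, Function.update_of_ne h14.symm]; ring
  by_cases d2 : d = c2
  · subst d2
    refine ⟨(-a2) * (e c1 - a1) * (e c3 - a3) * (e c4 - a4),
      (e c1 - a1) * (e c3 - a3) * (e c4 - a4), fun t => ?_⟩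
    simp only [Function.update_self, Function.update_of_ne h12,
      Function.update_of_ne h23.symm, Function.update_of_ne h24.symm]; ring
  by_cases d3 : d = c3
  · subst d3
    refine ⟨(-a3) * (e c1 - a1) * (e c2 - a2) * (e c4 - a4),
      (e c1 - a1) * (e c2 - a2) * (e c4 - a4), fun t => ?_⟩
    simp only [Function.update_self, Function.update_of_ne h13,
      Function.update_of_ne h23, Function.update_of_ne h34.symm]; ring
  by_cases d4 : d = c4
  · subst d4
    refine ⟨(-a4) * (e c1 - a1) * (e c2 - a2) * (e c3 - a3),
      (e c1 - a1) * (e c2 - a2) * (e c3 - a3), fun t => ?_⟩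
    simp only [Function.update_self, Function.update_of_ne h14,
      Function.update_of_ne h24, Function.update_of_ne h34]; ring
  · refine ⟨(e c1 - a1) * (e c2 - a2) * (e c3 - a3) * (e c4 - a4), 0, fun t => ?_⟩
    simp only [Function.update_of_ne (Ne.symm d1), Function.update_of_ne (Ne.symm d2),
      Function.update_of_ne (Ne.symm d3), Function.update_of_ne (Ne.symm d4)]; ring

lemma avg_inj {I K α : Type*} [Fintype I] [Fintype K] [Fintype α] [DecidableEq I] [DecidableEq K]
    [Nonempty α] (τ : K → I) (hτ : Function.Injective τ) (g : (K → α) → ℝ) :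
    (∑ r : I → α, g (r ∘ τ)) / (Fintype.card α : ℝ) ^ (Fintype.card I)
      = (∑ s : K → α, g s) / (Fintype.card α : ℝ) ^ (Fintype.card K) := by
  classical
  have main : ∃ C : ℝ, ∀ g : (K → α) → ℝ, ∑ r : I → α, g (r ∘ τ) = C * ∑ s : K → α, g s := by
    refine ⟨Fintype.card ({x // ¬ x ∈ Set.range τ} → α), fun g => ?_⟩
    rw [← (Equiv.piEquivPiSubtypeProd (fun x => x ∈ Set.range τ) (fun _ => α)).symm.sum_comp,
      Fintype.sum_prod_type]
    let e : ({x // x ∈ Set.range τ} → α) ≃ (K → α) :=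
      Equiv.arrowCongr (Equiv.ofInjective τ hτ).symm (Equiv.refl α)
    have : ∀ (a : {x // x ∈ Set.range τ} → α) (b : {x // ¬ x ∈ Set.range τ} → α),
      g (((Equiv.piEquivPiSubtypeProd (fun x => x ∈ Set.range τ) (fun _ => α)).symm (a, b)) ∘ τ)
        = g (e a) := by
      intro a b
      congr 1
      ext k
      simp only [Equiv.piEquivPiSubtypeProd, e, Equiv.arrowCongr, Function.comp_apply,
        Equiv.coe_fn_symm_mk, Set.mem_range_self, dif_pos, Equiv.coe_fn_mk, Equiv.symm_symm,
        Equiv.coe_refl, id]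
      rfl
    simp_rw [this]
    rw [← e.sum_comp g, Finset.mul_sum]
    refine Finset.sum_congr rfl fun a _ => ?_
    simp
  obtain ⟨C, hC⟩ := main
  have h1 := hC (fun _ => 1)
  simp only [Finset.sum_const, Finset.card_univ, Fintype.card_fun, nsmul_eq_mul, mul_one,
    Nat.cast_pow] at h1
  have hα : (0:ℝ) < Fintype.card α := by exact_mod_cast Fintype.card_pos
  rw [hC g, h1]
  have : C ≠ 0 := by
    rintro rfl
    rw [zero_mul] at h1
    exact (pow_pos hα _).ne' h1
  field_simp

lemma avg_pair {I α : Type*} [Fintype I] [Fintype α] [DecidableEq I]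
    [Nonempty α] (i j : I) (hij : i ≠ j) (g : α → α → ℝ) :
    (∑ r : I → α, g (r i) (r j)) / (Fintype.card α : ℝ) ^ (Fintype.card I)
      = (∑ a, ∑ b, g a b) / (Fintype.card α : ℝ) ^ 2 := by
  have h := avg_inj (α := α) ![i, j] (by
    intro a b; fin_cases a <;> fin_cases b <;> simp [hij, hij.symm]) (fun s => g (s 0) (s 1))
  simp only [Function.comp, Fintype.card_fin] at h
  refine Eq.trans ?_ (h.trans ?_)
  · rfl
  · rw [← (finTwoArrowEquiv α).symm.sum_comp, Fintype.sum_prod_type]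
    rfl

lemma exists_le_avg {I α : Type*} [Fintype I] [DecidableEq I] [Fintype α] [Nonempty α] (f : (I → α) → ℝ) :
    ∃ r, f r ≤ (∑ r : I → α, f r) / (Fintype.card α : ℝ) ^ (Fintype.card I) := by
  by_contra hcon
  push Not at hcon
  have hα : (0:ℝ) < (Fintype.card α : ℝ) ^ (Fintype.card I) := by
    have : (0:ℝ) < Fintype.card α := by exact_mod_cast Fintype.card_pos
    positivity
  have := Finset.sum_lt_sum_of_nonempty (s := (Finset.univ : Finset (I → α)))
    Finset.univ_nonempty (fun r _ => hcon r)
  simp only [Finset.sum_const, Finset.card_univ, Fintype.card_fun, nsmul_eq_mul,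
    Nat.cast_pow] at this
  rw [mul_div_cancel₀ _ hα.ne'] at this
  exact lt_irrefl _ this

lemma exists_perm {V κ : Type*} [Fintype V] [DecidableEq V] [Fintype κ] [DecidableEq κ]
    (p q : V → κ) :
    ∃ σ : Equiv.Perm V, ((Finset.univ.filter fun v => p (σ v) ≠ q v).card : ℝ) ≤
      ∑ c, |((Finset.univ.filter fun v => q v = c).card : ℝ) -
        ((Finset.univ.filter fun v => p v = c).card : ℝ)| := by
  obtain ⟨σ, hσ⟩ := Finite.exists_min
    (fun σ : Equiv.Perm V => (Finset.univ.filter fun v => p (σ v) ≠ q v).card)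
  refine ⟨σ, ?_⟩
  have hfib : (Finset.univ.filter fun v => p (σ v) ≠ q v).card =
      ∑ c, (Finset.univ.filter fun v => p (σ v) ≠ q v ∧ q v = c).card := by
    rw [Finset.card_eq_sum_card_fiberwise (f := q) (t := Finset.univ) (by simp)]
    refine Finset.sum_congr rfl fun c _ => ?_
    rw [Finset.filter_filter]
  rw [hfib]
  push_cast
  refine Finset.sum_le_sum fun c _ => ?_
  by_cases hne : ∃ v, p (σ v) ≠ q v ∧ q v = c
  swap
  · have : (Finset.univ.filter fun v => p (σ v) ≠ q v ∧ q v = c) = ∅ := by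
      ext v; simp only [Finset.mem_filter, Finset.mem_univ, true_and, Finset.notMem_empty, iff_false]
      exact fun h => hne ⟨v, h⟩
    rw [this]; simp
  obtain ⟨v, hv, hvc⟩ := hne
  have hall : ∀ v', p (σ v') = c → q v' = c := by
    intro v' hv'
    by_contra hq
    have hvv : v ≠ v' := by rintro rfl; exact hq hvc
    have hlt : (Finset.univ.filter fun x => p ((σ * Equiv.swap v v') x) ≠ q x).card <
        (Finset.univ.filter fun x => p (σ x) ≠ q x).card := by
      apply Finset.card_lt_card
      rw [Finset.ssubset_iff_of_subset]
      · refine ⟨v, by simpa using hv, ?_⟩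
        rw [Finset.mem_filter, Equiv.Perm.mul_apply, Equiv.swap_apply_left]
        rintro ⟨_, h⟩
        exact h (hv'.trans hvc.symm)
      · intro x hx
        rw [Finset.mem_filter] at hx ⊢
        refine ⟨Finset.mem_univ _, ?_⟩
        replace hx := hx.2
        rw [Equiv.Perm.mul_apply] at hx
        by_cases h1 : x = v
        · subst h1; exact hv
        by_cases h2 : x = v'
        · subst h2; rw [hv']; exact fun h => hq h.symm
        · rwa [Equiv.swap_apply_of_ne_of_ne h1 h2] at hx
    exact absurd (hσ (σ * Equiv.swap v v')) (not_le.2 hlt)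
  have hA : (Finset.univ.filter fun v => p v = c).card =
      (Finset.univ.filter fun v => p (σ v) = c).card := by
    symm
    apply Finset.card_bij (fun v _ => σ v)
    · simp
    · intro a _ b _ h; exact σ.injective h
    · intro b hb; exact ⟨σ.symm b, by simpa using hb, by simp⟩
  have hsplit : (Finset.univ.filter fun v => q v = c).card =
      (Finset.univ.filter fun v => p (σ v) ≠ q v ∧ q v = c).card +
      (Finset.univ.filter fun v => p (σ v) = c).card := by
    rw [← Finset.card_union_of_disjoint]
    · congr 1
      ext x
      simp only [Finset.mem_filter, Finset.mem_univ, true_and, Finset.mem_union]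
      constructor
      · intro h
        by_cases h' : p (σ x) = c
        · exact Or.inr h'
        · exact Or.inl ⟨by rw [h]; exact h', h⟩
      · rintro (h | h)
        · exact h.2
        · exact hall x h
    · rw [Finset.disjoint_filter]
      rintro x _ ⟨h1, h2⟩ h3
      exact h1 (h3.trans h2.symm)
  rw [hA, hsplit]
  push_cast
  rw [add_sub_cancel_right]
  exact le_abs_self _

lemma card_not_inj (n : ℕ) :
    ((Finset.univ.filter fun τ : Fin 4 → Fin n => ¬ Function.Injective τ).card : ℝ)
      ≤ 6 * (n:ℝ) ^ 3 := by
  classical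
  have h1 := Finset.card_filter_add_card_filter_not (s := (Finset.univ : Finset (Fin 4 → Fin n)))
    (fun τ => Function.Injective τ)
  have h2 : (Finset.univ.filter fun τ : Fin 4 → Fin n => Function.Injective τ).card
      = n.descFactorial 4 := by
    have := Fintype.card_embedding_eq (α := Fin 4) (β := Fin n)
    rw [Fintype.card_fin, Fintype.card_fin] at this
    rw [← this, ← Fintype.card_subtype]
    exact Fintype.card_congr (Equiv.subtypeInjectiveEquivEmbedding (Fin 4) (Fin n))
  have h3 : n ^ 4 ≤ n.descFactorial 4 + 6 * n ^ 3 := by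
    rcases Nat.lt_or_ge n 4 with h | h
    · interval_cases n <;> decide
    · obtain ⟨k, rfl⟩ := Nat.exists_eq_add_of_le h
      have : (4 + k).descFactorial 4 = (4 + k) * (3 + k) * (2 + k) * (1 + k) := by
        have e1 : 4 + k - 1 = 3 + k := by omega
        have e2 : 4 + k - 2 = 2 + k := by omega
        have e3 : 4 + k - 3 = 1 + k := by omega
        simp only [Nat.descFactorial, e1, e2, e3, Nat.sub_zero]
        ring
      rw [this]
      nlinarith
  rw [Finset.card_univ, Fintype.card_fun, Fintype.card_fin, Fintype.card_fin, h2] at h1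
  have : (Finset.univ.filter fun τ : Fin 4 → Fin n => ¬ Function.Injective τ).card ≤ 6 * n ^ 3 := by
    omega
  exact_mod_cast this

lemma P4_abs_le {V : Type*} (H : V → V → ℝ) (hb : ∀ x y, |H x y| ≤ 1) (q : Fin 4 → V) :
    |P4 H q| ≤ 1 := by
  unfold P4
  rw [abs_mul, abs_mul, abs_mul]
  refine mul_le_one₀ (mul_le_one₀ (mul_le_one₀ (hb _ _) (abs_nonneg _) (hb _ _))
    (abs_nonneg _) (hb _ _)) (abs_nonneg _) (hb _ _)

/-- edge selection -/
lemma edge_step {n : ℕ} (P W ub : Fin n → Fin n → ℝ) (hPs : ∀ i j, P i j = P j i)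
    (hP : ∀ i j, P i j ∈ Set.Icc (0:ℝ) 1) (α β : ℝ) :
    ∃ A : Fin n → Fin n → ℝ, (∀ i j, A i j = 0 ∨ A i j = 1) ∧ (∀ i j, A i j = A j i) ∧
      (∀ i, A i i = 0) ∧
      α * (∑ i, ∑ j, if i ≠ j then (A i j + ub i j - 2 * A i j * ub i j) else 0) +
        β * (∑ τ : Fin 4 → Fin n with Function.Injective τ, P4 (fun i j => A i j - W i j) τ) ≤
      α * (∑ i, ∑ j, if i ≠ j then (P i j + ub i j - 2 * P i j * ub i j) else 0) +
        β * (∑ τ : Fin 4 → Fin n with Function.Injective τ, P4 (fun i j => P i j - W i j) τ) := by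
  classical
  let F : (Sym2 (Fin n) → ℝ) → ℝ := fun e =>
    α * (∑ i, ∑ j, if i ≠ j then (e s(i, j) + ub i j - 2 * e s(i, j) * ub i j) else 0) +
    β * (∑ τ : Fin 4 → Fin n with Function.Injective τ, P4 (fun i j => e s(i, j) - W i j) τ)
  have hF : MAff F := by
    apply MAff.add
    · apply MAff.const_mul
      refine MAff.sum _ fun i _ => MAff.sum _ fun j _ => ?_
      by_cases h : i = j
      · simpa [h] using MAff.const 0
      · simp only [ne_eq, h, not_false_eq_true, if_true]
        have := ((MAff.coord (s(i, j))).const_mul (1 - 2 * ub i j)).add (MAff.const (ub i j))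
        convert this using 2
        ring
    · apply MAff.const_mul
      refine MAff.sum _ fun τ hτ => ?_
      have hi : Function.Injective τ := by simpa using hτ
      have h01 : τ 0 ≠ τ 1 := hi.ne (by decide)
      have h02 : τ 0 ≠ τ 2 := hi.ne (by decide)
      have h03 : τ 0 ≠ τ 3 := hi.ne (by decide)
      have h12 : τ 1 ≠ τ 2 := hi.ne (by decide)
      have h13 : τ 1 ≠ τ 3 := hi.ne (by decide)
      have h23 : τ 2 ≠ τ 3 := hi.ne (by decide)
      unfold P4
      apply MAff.prod4 <;> simp [Sym2.eq_iff] <;> tauto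
  let pr : Sym2 (Fin n) → ℝ := Sym2.lift ⟨P, hPs⟩
  obtain ⟨e, he, hle⟩ := hF.exists_le pr (by
    intro c; induction c using Sym2.ind with | _ x y => exact hP x y)
  refine ⟨fun i j => if i = j then 0 else e s(i, j), ?_, ?_, ?_, ?_⟩
  · intro i j
    by_cases h : i = j
    · simp [h]
    · simpa [h] using he s(i, j)
  · intro i j
    simp only [Sym2.eq_swap (a := i), eq_comm (a := i)]
  · intro i; simp
  · refine le_trans (le_of_eq ?_) hle
    simp only [F]
    congr 2
    · refine Finset.sum_congr rfl fun i _ => Finset.sum_congr rfl fun j _ => ?_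
      by_cases h : i = j <;> simp [h]
    · refine Finset.sum_congr rfl fun τ hτ => ?_
      have hi : Function.Injective τ := by simpa using hτ
      have h01 : τ 0 ≠ τ 1 := hi.ne (by decide)
      have h03 : τ 0 ≠ τ 3 := hi.ne (by decide)
      have h12 : τ 2 ≠ τ 1 := hi.ne (by decide)
      have h23 : τ 2 ≠ τ 3 := hi.ne (by decide)
      simp [P4, h01, h03, h12, h23]

def avg {I α : Type*} [Fintype I] [DecidableEq I] [Fintype α] (f : (I → α) → ℝ) : ℝ :=
  (∑ r : I → α, f r) / (Fintype.card α : ℝ) ^ (Fintype.card I)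

lemma avg_add {I α : Type*} [Fintype I] [DecidableEq I] [Fintype α] (f g : (I → α) → ℝ) :
    avg (fun r => f r + g r) = avg f + avg g := by
  unfold avg; rw [Finset.sum_add_distrib, add_div]

lemma avg_mul {I α : Type*} [Fintype I] [DecidableEq I] [Fintype α] (c : ℝ) (f : (I → α) → ℝ) :
    avg (fun r => c * f r) = c * avg f := by
  unfold avg; rw [← Finset.mul_sum, mul_div_assoc]

lemma avg_sum {I α J : Type*} [Fintype I] [DecidableEq I] [Fintype α] (s : Finset J)
    (f : J → (I → α) → ℝ) :
    avg (fun r => ∑ j ∈ s, f j r) = ∑ j ∈ s, avg (f j) := by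
  unfold avg; rw [Finset.sum_comm, Finset.sum_div]

/-- vertex selection -/
lemma vertex_step {n R k : ℕ} [NeZero R] (u H : Fin n × Fin R → Fin n × Fin R → ℝ)
    (p : Fin n × Fin R → Fin k) (ub : Fin n → Fin n → ℝ)
    (hub : ∀ i j, ub i j = (∑ s, ∑ s', u (i, s) (j, s')) / (R:ℝ) ^ 2)
    (π : Fin n → Fin k → ℝ)
    (hπ : ∀ i c, π i c = (∑ s, if p (i, s) = c then (1:ℝ) else 0) / R)
    (α β γ : ℝ) :
    ∃ r : Fin n → Fin R,
      α * (∑ i, ∑ j, if i ≠ j then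
        (u (i, r i) (j, r j) + ub i j - 2 * u (i, r i) (j, r j) * ub i j) else 0) +
      β * (∑ τ : Fin 4 → Fin n with Function.Injective τ,
        P4 (fun i j => H (i, r i) (j, r j)) τ) +
      γ * (∑ i, ∑ j, if i ≠ j then ∑ c, ((if p (i, r i) = c then (1:ℝ) else 0) - π i c) *
        ((if p (j, r j) = c then (1:ℝ) else 0) - π j c) else 0) ≤
      α * (∑ i, ∑ j, if i ≠ j then 2 * ub i j * (1 - ub i j) else 0) +
      β * ((∑ τ : Fin 4 → Fin n with Function.Injective τ, ∑ s : Fin 4 → Fin R,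
        P4 H (fun l => (τ l, s l))) / (R:ℝ) ^ 4) := by
  classical
  have hR : (R:ℝ) ≠ 0 := by exact_mod_cast NeZero.ne R
  have pair : ∀ (i j : Fin n), i ≠ j → ∀ g : Fin R → Fin R → ℝ,
      avg (fun r : Fin n → Fin R => g (r i) (r j)) = (∑ a, ∑ b, g a b) / (R:ℝ) ^ 2 := by
    intro i j hij g
    have := avg_pair (α := Fin R) i j hij g
    rw [Fintype.card_fin] at this
    rw [← this]; unfold avg; rw [Fintype.card_fin]
  obtain ⟨r, hr⟩ := exists_le_avg (I := Fin n) (α := Fin R) (fun r =>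
      α * (∑ i, ∑ j, if i ≠ j then
        (u (i, r i) (j, r j) + ub i j - 2 * u (i, r i) (j, r j) * ub i j) else 0) +
      β * (∑ τ : Fin 4 → Fin n with Function.Injective τ,
        P4 (fun i j => H (i, r i) (j, r j)) τ) +
      γ * (∑ i, ∑ j, if i ≠ j then ∑ c, ((if p (i, r i) = c then (1:ℝ) else 0) - π i c) *
        ((if p (j, r j) = c then (1:ℝ) else 0) - π j c) else 0))
  refine ⟨r, hr.trans (le_of_eq ?_)⟩
  change avg _ = _
  rw [avg_add, avg_add, avg_mul, avg_mul, avg_mul, avg_sum, avg_sum, avg_sum]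
  simp_rw [avg_sum]
  have z : ∑ i, ∑ j, avg (fun r : Fin n → Fin R => if i ≠ j then
      ∑ c, ((if p (i, r i) = c then (1:ℝ) else 0) - π i c) *
        ((if p (j, r j) = c then (1:ℝ) else 0) - π j c) else 0) = 0 := by
    refine Finset.sum_eq_zero fun i _ => Finset.sum_eq_zero fun j _ => ?_
    by_cases h : i = j
    · simp [h, avg]
    simp only [ne_eq, h, not_false_eq_true, if_true]
    rw [avg_sum]
    refine Finset.sum_eq_zero fun c _ => ?_
    rw [pair i j h (fun a b => ((if p (i, a) = c then (1:ℝ) else 0) - π i c) *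
        ((if p (j, b) = c then (1:ℝ) else 0) - π j c))]
    rw [← Finset.sum_mul_sum]
    have : ∑ a, ((if p (i, a) = c then (1:ℝ) else 0) - π i c) = 0 := by
      rw [Finset.sum_sub_distrib, hπ]
      simp only [Finset.sum_const, Finset.card_univ, Fintype.card_fin, nsmul_eq_mul]
      field_simp
      ring
    rw [this]; simp
  rw [z, mul_zero, add_zero]
  congr 2
  · refine Finset.sum_congr rfl fun i _ => Finset.sum_congr rfl fun j _ => ?_
    by_cases h : i = j
    · simp [h, avg]
    simp only [ne_eq, h, not_false_eq_true, if_true]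
    rw [pair i j h (fun a b => u (i, a) (j, b) + ub i j - 2 * u (i, a) (j, b) * ub i j)]
    have e1 : ∑ a, ∑ b, u (i, a) (j, b) = ub i j * (R:ℝ) ^ 2 := by
      rw [hub]; field_simp
    have e2 : ∑ a, ∑ b, (u (i, a) (j, b) + ub i j - 2 * u (i, a) (j, b) * ub i j) =
        (1 - 2 * ub i j) * ∑ a, ∑ b, u (i, a) (j, b) + (R:ℝ) ^ 2 * ub i j := by
      have : ∀ a b, u (i, a) (j, b) + ub i j - 2 * u (i, a) (j, b) * ub i j
        = (1 - 2 * ub i j) * u (i, a) (j, b) + ub i j := fun a b => by ring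
      simp_rw [this, Finset.sum_add_distrib, ← Finset.mul_sum]
      simp; ring
    rw [e2, e1]
    field_simp
    ring
  · rw [Finset.sum_div]
    refine Finset.sum_congr rfl fun τ hτ => ?_
    have hi : Function.Injective τ := by simpa using hτ
    have := avg_inj (α := Fin R) τ hi (fun s => P4 H (fun l => (τ l, s l)))
    rw [Fintype.card_fin, Fintype.card_fin, Fintype.card_fin] at this
    rw [← this]
    unfold avg
    rw [Fintype.card_fin, Fintype.card_fin]
    rfl

lemma t4_prod {n R : ℕ} (H : Fin n × Fin R → Fin n × Fin R → ℝ) :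
    t4 H = ∑ τ : Fin 4 → Fin n, ∑ s : Fin 4 → Fin R, P4 H (fun l => (τ l, s l)) := by
  unfold t4
  rw [← (Equiv.arrowProdEquivProdArrow (Fin 4) (fun _ => Fin n) (fun _ => Fin R)).symm.sum_comp,
    Fintype.sum_prod_type]
  rfl

/-- unnormalized L1 distance -/
def X1 {n R : ℕ} (u : Fin n × Fin R → Fin n × Fin R → ℝ) (A : Fin n → Fin n → ℝ) : ℝ :=
  ∑ i, ∑ j, ∑ s, ∑ s', |A i j - u (i, s) (j, s')|

lemma cell_l1 {n R : ℕ} [NeZero R] (u : Fin n × Fin R → Fin n × Fin R → ℝ)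
    (u01 : ∀ x y, u x y ∈ Set.Icc (0:ℝ) 1) (i j : Fin n) (a : ℝ) (ha : a = 0 ∨ a = 1)
    (ub : ℝ) (hub : ub = (∑ s, ∑ s', u (i, s) (j, s')) / (R:ℝ) ^ 2) :
    ∑ s, ∑ s', |a - u (i, s) (j, s')| = (R:ℝ) ^ 2 * (a + ub - 2 * a * ub) := by
  have hR : (R:ℝ) ≠ 0 := by exact_mod_cast NeZero.ne R
  have e1 : ∑ s, ∑ s', u (i, s) (j, s') = ub * (R:ℝ) ^ 2 := by
    rw [hub]; field_simp
  rcases ha with rfl | rfl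
  · have : ∀ s s', |0 - u (i, s) (j, s')| = u (i, s) (j, s') := fun s s' => by
      rw [zero_sub, abs_neg, abs_of_nonneg (u01 _ _).1]
    simp_rw [this]; rw [e1]; ring
  · have : ∀ s s', |1 - u (i, s) (j, s')| = 1 - u (i, s) (j, s') := fun s s' => by
      rw [abs_of_nonneg (by linarith [(u01 (i, s) (j, s')).2])]
    simp_rw [this, Finset.sum_sub_distrib]; rw [e1]; simp; ring

set_option maxHeartbeats 1600000 in
lemma select {n R k : ℕ} [NeZero n] [NeZero R] (u : Fin n × Fin R → Fin n × Fin R → ℝ)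
    (usym : ∀ x y, u x y = u y x) (u01 : ∀ x y, u x y ∈ Set.Icc (0:ℝ) 1)
    (p : Fin n × Fin R → Fin k) (w : Fin k → Fin k → ℝ)
    (w01 : ∀ a b, w a b ∈ Set.Icc (0:ℝ) 1) (δ : ℝ) (hδ : 0 < δ)
    (ht : t4 (fun x y => u x y - w (p x) (p y)) ≤ δ * ((n:ℝ) * R) ^ 4)
    (π : Fin n → Fin k → ℝ)
    (hπ : ∀ i c, π i c = (∑ s, if p (i, s) = c then (1:ℝ) else 0) / R)
    (A0 : Fin n → Fin n → ℝ) (A01 : ∀ i j, A0 i j = 0 ∨ A0 i j = 1)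
    (A0d : ∀ i, A0 i i = 0) (hX : 0 < X1 u A0) :
    ∃ (A : Fin n → Fin n → ℝ) (r : Fin n → Fin R), (∀ i j, A i j = 0 ∨ A i j = 1) ∧
      (∀ i j, A i j = A j i) ∧ (∀ i, A i i = 0) ∧ X1 u A ≤ 3 * X1 u A0 ∧
      t4 (fun i j => A i j - w (p (i, r i)) (p (j, r j))) ≤
        6 * (δ * (n:ℝ) ^ 4 + 12 * (n:ℝ) ^ 3) ∧
      ∑ c, (∑ i, ((if p (i, r i) = c then (1:ℝ) else 0) - π i c)) ^ 2 ≤ 12 * n := by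
  classical
  have hR0 : 0 < (R:ℝ) := by exact_mod_cast Nat.pos_of_ne_zero (NeZero.ne R)
  have hn0 : 0 < (n:ℝ) := by exact_mod_cast Nat.pos_of_ne_zero (NeZero.ne n)
  set H : Fin n × Fin R → Fin n × Fin R → ℝ := fun x y => u x y - w (p x) (p y) with hH
  have bd : ∀ a b : ℝ, a ∈ Set.Icc (0:ℝ) 1 → b ∈ Set.Icc (0:ℝ) 1 → |a - b| ≤ 1 := by
    intro a b ha hb
    rw [abs_le]; constructor <;> linarith [ha.1, ha.2, hb.1, hb.2]
  have Hb : ∀ x y, |H x y| ≤ 1 := fun x y => bd _ _ (u01 x y) (w01 _ _)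
  let ub : Fin n → Fin n → ℝ := fun i j => (∑ s, ∑ s', u (i, s) (j, s')) / (R:ℝ) ^ 2
  have ub01 : ∀ i j, ub i j ∈ Set.Icc (0:ℝ) 1 := by
    intro i j
    constructor
    · apply div_nonneg _ (by positivity)
      exact Finset.sum_nonneg fun s _ => Finset.sum_nonneg fun s' _ => (u01 _ _).1
    · apply div_le_one_of_le₀ _ (by positivity)
      calc ∑ s, ∑ s', u (i, s) (j, s') ≤ ∑ s : Fin R, ∑ s' : Fin R, (1:ℝ) :=
            Finset.sum_le_sum fun s _ => Finset.sum_le_sum fun s' _ => (u01 _ _).2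
        _ = (R:ℝ) ^ 2 := by simp [sq]
  -- decomposition of X1
  let Dg : ℝ := ∑ i, (R:ℝ) ^ 2 * ub i i
  have Dg0 : 0 ≤ Dg := Finset.sum_nonneg fun i _ => mul_nonneg (by positivity) (ub01 i i).1
  have X1eq : ∀ A : Fin n → Fin n → ℝ, (∀ i j, A i j = 0 ∨ A i j = 1) → (∀ i, A i i = 0) →
      X1 u A = (R:ℝ) ^ 2 * (∑ i, ∑ j, if i ≠ j then
        (A i j + ub i j - 2 * A i j * ub i j) else 0) + Dg := by
    intro A hA hAd
    have : Dg = ∑ i, ∑ j, if i = j then (R:ℝ) ^ 2 * ub i j else 0 := by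
      simp [Dg]
    rw [this]
    unfold X1
    simp_rw [Finset.mul_sum, ← Finset.sum_add_distrib]
    refine Finset.sum_congr rfl fun i _ => Finset.sum_congr rfl fun j _ => ?_
    rw [cell_l1 u u01 i j (A i j) (hA i j) (ub i j) rfl]
    by_cases h : i = j
    · subst h; simp [hAd]
    · simp [h]
  let β : ℝ := 1 / (8 * (δ * (n:ℝ) ^ 4 + 12 * (n:ℝ) ^ 3))
  let γ : ℝ := 1 / (16 * n)
  let α : ℝ := (R:ℝ) ^ 2 / (4 * X1 u A0)
  have hβ : 0 < β := by positivity
  have hγ : 0 < γ := by positivity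
  obtain ⟨r, hr⟩ := vertex_step u H p ub (fun i j => rfl) π hπ α β γ
  obtain ⟨A, hA01, hAs, hAd, hA⟩ := edge_step (fun i j => u (i, r i) (j, r j))
    (fun i j => w (p (i, r i)) (p (j, r j))) ub (fun i j => usym _ _) (fun i j => u01 _ _) α β
  set K : Fin n → Fin n → ℝ := fun i j => A i j - w (p (i, r i)) (p (j, r j)) with hK
  have A01' : ∀ i j, A i j ∈ Set.Icc (0:ℝ) 1 := fun i j => by
    rcases hA01 i j with h | h <;> rw [h] <;> simp
  have Kb : ∀ x y, |K x y| ≤ 1 := fun x y => bd _ _ (A01' x y) (w01 _ _)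
  -- names
  set SA := ∑ i, ∑ j, if i ≠ j then (A i j + ub i j - 2 * A i j * ub i j) else 0 with hSA
  set TA := ∑ τ : Fin 4 → Fin n with Function.Injective τ, P4 K τ with hTA
  set Dr := ∑ i, ∑ j, if i ≠ j then ∑ c, ((if p (i, r i) = c then (1:ℝ) else 0) - π i c) *
        ((if p (j, r j) = c then (1:ℝ) else 0) - π j c) else 0 with hDr
  set S0 := ∑ i, ∑ j, if i ≠ j then 2 * ub i j * (1 - ub i j) else 0 with hS0
  set T0 := (∑ τ : Fin 4 → Fin n with Function.Injective τ, ∑ s : Fin 4 → Fin R,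
        P4 H (fun l => (τ l, s l))) / (R:ℝ) ^ 4 with hT0
  have tot : α * SA + β * TA + γ * Dr ≤ α * S0 + β * T0 := by
    have : ∀ i j, u (i, r i) (j, r j) - w (p (i, r i)) (p (j, r j)) = H (i, r i) (j, r j) :=
      fun i j => rfl
    simp only [this] at hA
    linarith
  -- bound T0
  have hT0b : T0 ≤ δ * (n:ℝ) ^ 4 + 6 * (n:ℝ) ^ 3 := by
    rw [hT0, div_le_iff₀ (by positivity)]
    rw [t4_prod, ← Finset.sum_filter_add_sum_filter_not Finset.univ
      (fun τ : Fin 4 → Fin n => Function.Injective τ)] at ht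
    have : -(6 * (n:ℝ) ^ 3 * (R:ℝ) ^ 4) ≤ ∑ τ : Fin 4 → Fin n with ¬ Function.Injective τ,
        ∑ s : Fin 4 → Fin R, P4 H (fun l => (τ l, s l)) := by
      calc -(6 * (n:ℝ) ^ 3 * (R:ℝ) ^ 4) ≤
          -(((Finset.univ.filter fun τ : Fin 4 → Fin n => ¬ Function.Injective τ).card : ℝ)
            * (R:ℝ) ^ 4) := by
            have := card_not_inj n
            have hR4 : 0 ≤ (R:ℝ) ^ 4 := by positivity
            nlinarith
        _ = ∑ τ : Fin 4 → Fin n with ¬ Function.Injective τ, ∑ s : Fin 4 → Fin R, (-1 : ℝ) := by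
            simp
        _ ≤ _ := Finset.sum_le_sum fun τ _ => Finset.sum_le_sum fun s _ =>
            (abs_le.1 (P4_abs_le H Hb _)).1
    nlinarith
  -- t4 K versus TA
  have hnon : |∑ τ : Fin 4 → Fin n with ¬ Function.Injective τ, P4 K τ| ≤ 6 * (n:ℝ) ^ 3 := by
    refine (Finset.abs_sum_le_sum_abs _ _).trans ?_
    calc _ ≤ ∑ τ : Fin 4 → Fin n with ¬ Function.Injective τ, (1:ℝ) :=
          Finset.sum_le_sum fun τ _ => P4_abs_le K Kb τ
      _ ≤ _ := by simpa using card_not_inj n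
  have hK4 : t4 K = TA + ∑ τ : Fin 4 → Fin n with ¬ Function.Injective τ, P4 K τ := by
    unfold t4
    rw [← Finset.sum_filter_add_sum_filter_not Finset.univ
      (fun τ : Fin 4 → Fin n => Function.Injective τ)]
  have hK0 := t4_nonneg K
  have hTAlow : 0 ≤ TA + 6 * (n:ℝ) ^ 3 := by linarith [(abs_le.1 hnon).2]
  -- discrepancy
  set D := ∑ c, (∑ i, ((if p (i, r i) = c then (1:ℝ) else 0) - π i c)) ^ 2 with hD
  have π0 : ∀ i c, 0 ≤ π i c := by
    intro i c
    rw [hπ]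
    apply div_nonneg _ hR0.le
    exact Finset.sum_nonneg fun s _ => by split_ifs <;> norm_num
  have πsum : ∀ i, ∑ c, π i c = 1 := by
    intro i
    simp_rw [hπ]
    rw [← Finset.sum_div, Finset.sum_comm]
    simp [hR0.ne']
  have hDD : D ≤ Dr + 2 * n := by
    have e1 : D = ∑ i, ∑ j, ∑ c, ((if p (i, r i) = c then (1:ℝ) else 0) - π i c) *
        ((if p (j, r j) = c then (1:ℝ) else 0) - π j c) := by
      rw [hD]
      simp_rw [sq, Finset.sum_mul_sum]
      rw [Finset.sum_comm]
      refine Finset.sum_congr rfl fun i _ => ?_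
      rw [Finset.sum_comm]
    have e2 : (2 * n : ℝ) = ∑ i : Fin n, ∑ j : Fin n, if i = j then (2:ℝ) else 0 := by
      simp; ring
    rw [e1, e2, hDr]
    simp_rw [← Finset.sum_add_distrib]
    refine Finset.sum_le_sum fun i _ => Finset.sum_le_sum fun j _ => ?_
    by_cases h : i = j
    · subst h
      simp only [ne_eq, not_true_eq_false, if_false, if_true, zero_add]
      have hle : ∀ c, ((if p (i, r i) = c then (1:ℝ) else 0) - π i c) *
          ((if p (i, r i) = c then (1:ℝ) else 0) - π i c) ≤
          (if p (i, r i) = c then (1:ℝ) else 0) + π i c := by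
        intro c
        have h0 := π0 i c
        have h1 : π i c ≤ 1 := by
          rw [← πsum i]
          exact Finset.single_le_sum (f := fun c => π i c) (fun c _ => π0 i c) (Finset.mem_univ c)
        split_ifs <;> nlinarith
      refine (Finset.sum_le_sum fun c _ => hle c).trans ?_
      rw [Finset.sum_add_distrib, πsum]
      simp; norm_num
    · simp [h]
  have hD0 : 0 ≤ D := by positivity
  -- S0 bound
  have hS0b : (R:ℝ) ^ 2 * S0 + Dg ≤ 2 * X1 u A0 := by
    rw [X1eq A0 A01 A0d]
    have : S0 ≤ 2 * ∑ i, ∑ j, if i ≠ j then (A0 i j + ub i j - 2 * A0 i j * ub i j) else 0 := by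
      rw [hS0]
      simp_rw [Finset.mul_sum]
      refine Finset.sum_le_sum fun i _ => Finset.sum_le_sum fun j _ => ?_
      by_cases h : i = j
      · simp [h]
      simp only [ne_eq, h, not_false_eq_true, if_true]
      have := ub01 i j
      rcases A01 i j with h | h <;> rw [h] <;> nlinarith [this.1, this.2]
    have hR2 : 0 ≤ (R:ℝ) ^ 2 := by positivity
    have h2 := mul_le_mul_of_nonneg_left this hR2
    clear_value S0 Dg
    clear hTAlow hK0 hK4 hnon this
    generalize (∑ i, ∑ j, if i ≠ j then (A0 i j + ub i j - 2 * A0 i j * ub i j) else 0) = Z at h2 ⊢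
    linarith
  have hXA := X1eq A hA01 hAd
  have hXA0 : 0 ≤ X1 u A := by
    unfold X1; positivity
  -- total
  have c1 : α * SA = (X1 u A - Dg) / (4 * X1 u A0) := by
    rw [hXA, ← hSA]; simp only [α]; field_simp; ring
  have c2 : α * S0 ≤ (2 * X1 u A0 - Dg) / (4 * X1 u A0) := by
    simp only [α]
    rw [div_mul_eq_mul_div]
    gcongr
    linarith
  have c3 : β * (T0 + 6 * (n:ℝ) ^ 3) ≤ 1 / 8 := by
    calc β * (T0 + 6 * (n:ℝ) ^ 3) ≤ β * (δ * (n:ℝ) ^ 4 + 12 * (n:ℝ) ^ 3) := by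
          apply mul_le_mul_of_nonneg_left _ hβ.le; linarith
      _ = 1 / 8 := by simp only [β]; field_simp
  have c4 : γ * (2 * n) = 1 / 8 := by simp only [γ]; field_simp; norm_num
  have c5 : (2 * X1 u A0 - Dg) / (4 * X1 u A0) = 1 / 2 - Dg / (4 * X1 u A0) := by
    field_simp; ring
  have c6 : (X1 u A - Dg) / (4 * X1 u A0) = X1 u A / (4 * X1 u A0) - Dg / (4 * X1 u A0) := by
    rw [sub_div]
  have fin : X1 u A / (4 * X1 u A0) + β * (TA + 6 * (n:ℝ) ^ 3) + γ * (Dr + 2 * n) ≤ 3 / 4 := by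
    have : β * (TA + 6 * (n:ℝ) ^ 3) = β * TA + β * (6 * (n:ℝ) ^ 3) := by ring
    have h2 : β * (T0 + 6 * (n:ℝ) ^ 3) = β * T0 + β * (6 * (n:ℝ) ^ 3) := by ring
    have h3 : γ * (Dr + 2 * n) = γ * Dr + γ * (2 * n) := by ring
    linarith
  have f1 : 0 ≤ X1 u A / (4 * X1 u A0) := by positivity
  have f2 : 0 ≤ β * (TA + 6 * (n:ℝ) ^ 3) := mul_nonneg hβ.le hTAlow
  have f3 : 0 ≤ γ * (Dr + 2 * n) := mul_nonneg hγ.le (hD0.trans hDD)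
  refine ⟨A, r, hA01, hAs, hAd, ?_, ?_, ?_⟩
  · have : X1 u A / (4 * X1 u A0) ≤ 3 / 4 := by linarith
    rw [div_le_iff₀ (by positivity)] at this
    linarith
  · have h1 : β * (TA + 6 * (n:ℝ) ^ 3) ≤ 3 / 4 := by linarith
    have h2 : t4 K ≤ TA + 6 * (n:ℝ) ^ 3 := by rw [hK4]; linarith [(abs_le.1 hnon).2]
    have h3 : TA + 6 * (n:ℝ) ^ 3 ≤ 3 / 4 / β := by rw [le_div_iff₀ hβ]; linarith
    have h4 : 3 / 4 / β = 6 * (δ * (n:ℝ) ^ 4 + 12 * (n:ℝ) ^ 3) := by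
      simp only [β]; field_simp; norm_num
    linarith
  · have h1 : γ * (Dr + 2 * n) ≤ 3 / 4 := by linarith
    have h3 : Dr + 2 * n ≤ 3 / 4 / γ := by rw [le_div_iff₀ hγ]; linarith
    have h4 : 3 / 4 / γ = 12 * n := by
      simp only [γ]; field_simp; norm_num
    linarith

set_option maxHeartbeats 1600000 in
lemma finite_main {n R : ℕ} [NeZero n] [NeZero R] (u : Fin n × Fin R → Fin n × Fin R → ℝ)
    (usym : ∀ x y, u x y = u y x) (u01 : ∀ x y, u x y ∈ Set.Icc (0:ℝ) 1)
    (ε : ℝ) (hε : 0 < ε) (m : ℕ) (hm : 1 < m * (ε ^ 4) ^ 2)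
    (hn1 : 12 ≤ ε ^ 4 * n) (hn2 : 12 * (4:ℝ) ^ m ≤ ε ^ 2 * n)
    (A0 : Fin n → Fin n → ℝ) (A01 : ∀ i j, A0 i j = 0 ∨ A0 i j = 1)
    (A0d : ∀ i, A0 i i = 0) (hX : 0 < X1 u A0) :
    ∃ (A : Fin n → Fin n → ℝ) (σ : Equiv.Perm (Fin n × Fin R)), (∀ i j, A i j = 0 ∨ A i j = 1) ∧
      (∀ i j, A i j = A j i) ∧ (∀ i, A i i = 0) ∧ X1 u A ≤ 3 * X1 u A0 ∧
      ∀ s t : Fin n × Fin R → ℝ, (∀ v, |s v| ≤ 1) → (∀ v, |t v| ≤ 1) →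
        |∑ x, ∑ y, s x * t y * (A x.1 y.1 - u (σ x) (σ y))| ≤ 5 * ε * ((n:ℝ) * R) ^ 2 := by
  classical
  have hR0 : 0 < (R:ℝ) := by exact_mod_cast Nat.pos_of_ne_zero (NeZero.ne R)
  have hn0 : 0 < (n:ℝ) := by exact_mod_cast Nat.pos_of_ne_zero (NeZero.ne n)
  have hcard : ((Fintype.card (Fin n × Fin R) : ℕ) : ℝ) = n * R := by simp
  obtain ⟨k, p, w, hk, wsym, w01, ht⟩ := regularity u usym u01 (ε ^ 4) (by positivity) m hm
  rw [hcard] at ht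
  obtain ⟨A, r, hA01, hAs, hAd, hXA, hK, hD⟩ := select u usym u01 p w w01 (ε ^ 4) (by positivity) ht
    (fun i c => (∑ s, if p (i, s) = c then (1:ℝ) else 0) / R) (fun i c => rfl) A0 A01 A0d hX
  let q : Fin n × Fin R → Fin k := fun v => p (v.1, r v.1)
  obtain ⟨σ, hσ⟩ := exists_perm p q
  set N : ℝ := (n:ℝ) * R with hN
  have hN0 : 0 < N := by positivity
  -- number of bad vertices
  have hbad : ((Finset.univ.filter fun v => p (σ v) ≠ q v).card : ℝ) ≤ ε * N := by
    refine hσ.trans ?_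
    have hd : ∀ c, ((Finset.univ.filter fun v => q v = c).card : ℝ) -
        ((Finset.univ.filter fun v => p v = c).card : ℝ) =
        R * ∑ i, ((if p (i, r i) = c then (1:ℝ) else 0) -
          (∑ s, if p (i, s) = c then (1:ℝ) else 0) / R) := by
      intro c
      rw [Finset.card_filter, Finset.card_filter]
      push_cast
      rw [Fintype.sum_prod_type, Fintype.sum_prod_type, ← Finset.sum_sub_distrib, Finset.mul_sum]
      refine Finset.sum_congr rfl fun i _ => ?_
      rw [mul_sub, mul_div_cancel₀ _ hR0.ne']
      congr 1
      simp only [q]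
      split_ifs <;> simp
    simp_rw [hd, abs_mul, abs_of_pos hR0, ← Finset.mul_sum]
    set dd : Fin k → ℝ := fun c => ∑ i, ((if p (i, r i) = c then (1:ℝ) else 0) -
          (∑ s, if p (i, s) = c then (1:ℝ) else 0) / R) with hdd
    have cs := Finset.sum_mul_sq_le_sq_mul_sq Finset.univ (fun _ : Fin k => (1:ℝ)) (fun c => |dd c|)
    simp only [one_mul, one_pow, Finset.sum_const, Finset.card_univ, Fintype.card_fin,
      nsmul_eq_mul, mul_one, sq_abs] at cs
    have hk' : (k:ℝ) ≤ (4:ℝ) ^ m := by exact_mod_cast hk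
    have hDD : ∑ c, dd c ^ 2 ≤ 12 * n := hD
    have : (∑ c, |dd c|) ^ 2 ≤ (ε * n) ^ 2 := by
      calc (∑ c, |dd c|) ^ 2 ≤ k * ∑ c, dd c ^ 2 := cs
        _ ≤ (4:ℝ) ^ m * (12 * n) := by gcongr
        _ = (12 * (4:ℝ) ^ m) * n := by ring
        _ ≤ (ε ^ 2 * n) * n := by gcongr
        _ = _ := by ring
    have h2 : ∑ c, |dd c| ≤ ε * n := by
      exact le_of_sq_le_sq this (by positivity)
    calc (R:ℝ) * ∑ c, |dd c| ≤ R * (ε * n) := by gcongr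
      _ = ε * N := by rw [hN]; ring
  refine ⟨A, σ, hA01, hAs, hAd, hXA, ?_⟩
  intro s t hs ht'
  -- three pieces
  have split : ∑ x, ∑ y, s x * t y * (A x.1 y.1 - u (σ x) (σ y)) =
      ∑ x, ∑ y, s x * t y * (A x.1 y.1 - w (q x) (q y)) +
      ∑ x, ∑ y, s x * t y * (w (q x) (q y) - w (p (σ x)) (p (σ y))) -
      ∑ x, ∑ y, s x * t y * (u (σ x) (σ y) - w (p (σ x)) (p (σ y))) := by
    simp_rw [← Finset.sum_add_distrib, ← Finset.sum_sub_distrib]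
    refine Finset.sum_congr rfl fun x _ => Finset.sum_congr rfl fun y _ => by ring
  have b1 : |∑ x, ∑ y, s x * t y * (A x.1 y.1 - w (q x) (q y))| ≤ 2 * ε * N ^ 2 := by
    have h := cut_le_t4 (fun x y : Fin n × Fin R => A x.1 y.1 - w (q x) (q y)) s t hs ht'
    rw [hcard] at h
    have ht4 : t4 (fun x y : Fin n × Fin R => A x.1 y.1 - w (q x) (q y)) =
        t4 (fun i j => A i j - w (p (i, r i)) (p (j, r j))) * (R:ℝ) ^ 4 := by
      rw [t4_prod]
      unfold t4
      rw [Finset.sum_mul]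
      refine Finset.sum_congr rfl fun τ _ => ?_
      simp only [P4, q, Finset.sum_const, Finset.card_univ, Fintype.card_fun, Fintype.card_fin,
        nsmul_eq_mul]
      push_cast; ring
    rw [ht4] at h
    have h2 : (∑ x, ∑ y, s x * t y * (A x.1 y.1 - w (q x) (q y))) ^ 4 ≤ (2 * ε * N ^ 2) ^ 4 := by
      refine h.trans ?_
      calc N ^ 4 * (t4 (fun i j => A i j - w (p (i, r i)) (p (j, r j))) * (R:ℝ) ^ 4)
          ≤ N ^ 4 * (6 * (ε ^ 4 * (n:ℝ) ^ 4 + 12 * (n:ℝ) ^ 3) * (R:ℝ) ^ 4) := by gcongr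
        _ ≤ N ^ 4 * (6 * (ε ^ 4 * (n:ℝ) ^ 4 + (ε ^ 4 * n) * (n:ℝ) ^ 3) * (R:ℝ) ^ 4) := by gcongr
        _ = 12 * ε ^ 4 * N ^ 8 := by rw [hN]; ring
        _ ≤ 16 * ε ^ 4 * N ^ 8 := by gcongr; norm_num
        _ = _ := by ring
    exact abs_le_of_sq_le_sq (by
      have e : ∀ z : ℝ, z ^ 4 = (z ^ 2) ^ 2 := fun z => by ring
      rw [e, e] at h2
      exact le_of_sq_le_sq h2 (by positivity)) (by positivity)
  have b3 : |∑ x, ∑ y, s x * t y * (u (σ x) (σ y) - w (p (σ x)) (p (σ y)))| ≤ ε * N ^ 2 := by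
    have h := cut_le_t4 (fun x y => u x y - w (p x) (p y)) (s ∘ σ.symm) (t ∘ σ.symm)
      (fun v => hs _) (fun v => ht' _)
    rw [hcard] at h
    have e0 : ∑ x, ∑ y, s x * t y * (u (σ x) (σ y) - w (p (σ x)) (p (σ y))) =
        ∑ x, ∑ y, (s ∘ σ.symm) x * (t ∘ σ.symm) y * (u x y - w (p x) (p y)) := by
      rw [← Equiv.sum_comp σ (fun x => ∑ y, (s ∘ σ.symm) x * (t ∘ σ.symm) y *
        (u x y - w (p x) (p y)))]
      refine Finset.sum_congr rfl fun x _ => ?_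
      rw [← Equiv.sum_comp σ (fun y => (s ∘ σ.symm) (σ x) * (t ∘ σ.symm) y *
        (u (σ x) y - w (p (σ x)) (p y)))]
      refine Finset.sum_congr rfl fun y _ => ?_
      simp
    rw [e0]
    have h2 := h.trans (mul_le_mul_of_nonneg_left ht (by positivity))
    have e1 : N ^ 4 * (ε ^ 4 * N ^ 4) = (ε * N ^ 2) ^ 4 := by ring
    rw [e1] at h2
    exact abs_le_of_sq_le_sq (by
      have e : ∀ z : ℝ, z ^ 4 = (z ^ 2) ^ 2 := fun z => by ring
      rw [e, e (ε * N ^ 2)] at h2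
      exact le_of_sq_le_sq h2 (by positivity)) (by positivity)
  have b2 : |∑ x, ∑ y, s x * t y * (w (q x) (q y) - w (p (σ x)) (p (σ y)))| ≤ 2 * ε * N ^ 2 := by
    refine (Finset.abs_sum_le_sum_abs _ _).trans ?_
    calc ∑ x, |∑ y, s x * t y * (w (q x) (q y) - w (p (σ x)) (p (σ y)))|
        ≤ ∑ x, ∑ y, ((if p (σ x) ≠ q x then (1:ℝ) else 0) + (if p (σ y) ≠ q y then (1:ℝ) else 0)) := by
          refine Finset.sum_le_sum fun x _ => (Finset.abs_sum_le_sum_abs _ _).trans ?_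
          refine Finset.sum_le_sum fun y _ => ?_
          rw [abs_mul, abs_mul]
          have h1 : |s x| * |t y| ≤ 1 := mul_le_one₀ (hs x) (abs_nonneg _) (ht' y)
          refine (mul_le_of_le_one_left (abs_nonneg _) h1).trans ?_
          have hw : |w (q x) (q y) - w (p (σ x)) (p (σ y))| ≤ 1 := by
            have ha := w01 (q x) (q y); have hb := w01 (p (σ x)) (p (σ y))
            rw [abs_le]; constructor <;> linarith [ha.1, ha.2, hb.1, hb.2]
          by_cases hx : p (σ x) = q x
          · by_cases hy : p (σ y) = q y
            · simp [hx, hy]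
            · simpa [hx, hy] using hw
          · simp only [ne_eq, hx, not_false_eq_true, if_true]
            have : (0:ℝ) ≤ if ¬ p (σ y) = q y then (1:ℝ) else 0 := by split_ifs <;> norm_num
            linarith
      _ = 2 * N * ((Finset.univ.filter fun v => p (σ v) ≠ q v).card : ℝ) := by
          rw [Finset.card_filter]
          push_cast
          simp_rw [Finset.sum_add_distrib]
          simp only [Finset.sum_const, Finset.card_univ, nsmul_eq_mul, ← Finset.mul_sum]
          rw [hcard]; ring
      _ ≤ 2 * N * (ε * N) := by gcongr
      _ = _ := by ring
  rw [split]
  calc _ ≤ _ := abs_sub _ _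
    _ ≤ (2 * ε * N ^ 2 + 2 * ε * N ^ 2) + ε * N ^ 2 := by
        gcongr
        exact (abs_add_le _ _).trans (add_le_add b1 b2)
    _ = _ := by ring

/-- index of the grid interval `(a/N,(a+1)/N]` containing `x` -/
def cellN (N : ℕ) [NeZero N] (x : ℝ) : Fin N :=
  ⟨min (⌈x * N⌉₊ - 1) (N - 1), by have := Nat.pos_of_ne_zero (NeZero.ne N); omega⟩

lemma cellN_meas (N : ℕ) [NeZero N] : Measurable (cellN N) := by
  have h1 : Measurable fun x : ℝ => ⌈x * N⌉₊ :=
    Nat.measurable_ceil.comp (measurable_id.mul_const _)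
  have h2 : Measurable fun k : ℕ => (⟨min (k - 1) (N - 1), by
    have := Nat.pos_of_ne_zero (NeZero.ne N); omega⟩ : Fin N) := measurable_from_top
  exact h2.comp h1

lemma cellN_eq_iff {N : ℕ} [NeZero N] {x : ℝ} (hx : x ∈ Set.Ioc (0:ℝ) 1) (a : Fin N) :
    cellN N x = a ↔ x ∈ Set.Ioc ((a : ℕ) / (N:ℝ)) (((a : ℕ) + 1) / (N:ℝ)) := by
  have hN : 0 < (N:ℝ) := by exact_mod_cast Nat.pos_of_ne_zero (NeZero.ne N)
  have h0 : 0 < ⌈x * N⌉₊ := Nat.ceil_pos.2 (mul_pos hx.1 hN)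
  have h1 : ⌈x * N⌉₊ ≤ N := Nat.ceil_le.2 (by nlinarith [hx.2])
  have ha := a.2
  rw [Set.mem_Ioc, div_lt_iff₀ hN, le_div_iff₀ hN, ← Nat.lt_ceil]
  have h2 : x * N ≤ (a:ℕ) + 1 ↔ ⌈x * N⌉₊ ≤ (a:ℕ) + 1 := by
    rw [Nat.ceil_le]; push_cast; rfl
  rw [h2, cellN, Fin.ext_iff]
  simp only
  omega

lemma Ioc_sub {N : ℕ} [NeZero N] (a : Fin N) :
    Set.Ioc ((a : ℕ) / (N:ℝ)) (((a : ℕ) + 1) / (N:ℝ)) ⊆ Set.Ioc (0:ℝ) 1 := by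
  have hN : 0 < (N:ℝ) := by exact_mod_cast Nat.pos_of_ne_zero (NeZero.ne N)
  apply Set.Ioc_subset_Ioc
  · positivity
  · rw [div_le_one hN]; exact_mod_cast a.2

lemma cellN_inter {N : ℕ} [NeZero N] (a : Fin N) :
    cellN N ⁻¹' {a} ∩ Set.Ioc (0:ℝ) 1 =
      Set.Ioc ((a : ℕ) / (N:ℝ)) (((a : ℕ) + 1) / (N:ℝ)) := by
  ext x
  constructor
  · rintro ⟨h1, h2⟩; exact (cellN_eq_iff h2 a).1 h1
  · intro h
    exact ⟨(cellN_eq_iff (Ioc_sub a h) a).2 h, Ioc_sub a h⟩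

lemma restr_eq : volume.restrict I01 = volume.restrict (Set.Ioc (0:ℝ) 1) :=
  (Measure.restrict_congr_set Ioc_ae_eq_Icc).symm

lemma ae_Ioc : ∀ᵐ x ∂(volume.restrict I01), x ∈ Set.Ioc (0:ℝ) 1 := by
  rw [restr_eq]; exact ae_restrict_mem measurableSet_Ioc

lemma I01_meas : MeasurableSet I01 := measurableSet_Icc

lemma cellN_vol {N : ℕ} [NeZero N] (a : Fin N) :
    (volume.restrict I01) (cellN N ⁻¹' {a}) = ENNReal.ofReal (1 / N) := by
  rw [restr_eq, Measure.restrict_apply (cellN_meas N (measurableSet_singleton a)), cellN_inter,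
    Real.volume_Ioc]
  congr 1; ring

instance : IsProbabilityMeasure (volume.restrict I01) := by
  constructor; simp [I01]

/-- translation of grid intervals according to a permutation -/
def phi {N : ℕ} [NeZero N] (σ : Equiv.Perm (Fin N)) (x : ℝ) : ℝ :=
  if x ∈ Set.Ioc (0:ℝ) 1 then x + (((σ (cellN N x) : ℕ) : ℝ) - ((cellN N x : ℕ) : ℝ)) / N else x

lemma phi_meas {N : ℕ} [NeZero N] (σ : Equiv.Perm (Fin N)) : Measurable (phi σ) := by
  unfold phi
  refine Measurable.ite measurableSet_Ioc ?_ measurable_id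
  have h : Measurable fun k : Fin N => (((σ k : ℕ) : ℝ) - ((k : ℕ) : ℝ)) / N := .of_discrete
  exact measurable_id.add (h.comp (cellN_meas N))

lemma phi_mem {N : ℕ} [NeZero N] (σ : Equiv.Perm (Fin N)) {x : ℝ} (hx : x ∈ Set.Ioc (0:ℝ) 1) :
    phi σ x ∈ Set.Ioc (((σ (cellN N x)) : ℕ) / (N:ℝ)) ((((σ (cellN N x)) : ℕ) + 1) / (N:ℝ)) := by
  have h := (cellN_eq_iff hx (cellN N x)).1 rfl
  rw [phi, if_pos hx]
  rw [Set.mem_Ioc, add_div] at *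
  rw [sub_div]
  constructor <;> linarith [h.1, h.2]

lemma phi_cell {N : ℕ} [NeZero N] (σ : Equiv.Perm (Fin N)) {x : ℝ} (hx : x ∈ Set.Ioc (0:ℝ) 1) :
    cellN N (phi σ x) = σ (cellN N x) :=
  (cellN_eq_iff (Ioc_sub _ (phi_mem σ hx)) _).2 (phi_mem σ hx)

lemma phi_Ioc {N : ℕ} [NeZero N] (σ : Equiv.Perm (Fin N)) {x : ℝ} (hx : x ∈ Set.Ioc (0:ℝ) 1) :
    phi σ x ∈ Set.Ioc (0:ℝ) 1 := Ioc_sub _ (phi_mem σ hx)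

lemma phi_I01 {N : ℕ} [NeZero N] (σ : Equiv.Perm (Fin N)) {x : ℝ} (hx : x ∈ I01) :
    phi σ x ∈ I01 := by
  by_cases h : x ∈ Set.Ioc (0:ℝ) 1
  · exact Set.Ioc_subset_Icc_self (phi_Ioc σ h)
  · rw [phi, if_neg h]; exact hx

lemma phi_inv {N : ℕ} [NeZero N] (σ : Equiv.Perm (Fin N)) (x : ℝ) :
    phi σ.symm (phi σ x) = x := by
  by_cases h : x ∈ Set.Ioc (0:ℝ) 1
  · have h2 := phi_Ioc σ h
    have h3 := phi_cell σ h
    rw [phi, if_pos h2, h3, phi, if_pos h, Equiv.symm_apply_apply]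
    ring
  · have : phi σ x = x := by rw [phi, if_neg h]
    rw [this, phi, if_neg h]

lemma restr_sum {N : ℕ} [NeZero N] (C : Set ℝ) (hC : MeasurableSet C) :
    (volume.restrict I01) C =
      ∑ a : Fin N, volume (C ∩ Set.Ioc ((a : ℕ) / (N:ℝ)) (((a : ℕ) + 1) / (N:ℝ))) := by
  rw [restr_eq]
  have h := sum_measure_preimage_singleton (μ := (volume.restrict (Set.Ioc (0:ℝ) 1)).restrict C)
    (Finset.univ : Finset (Fin N)) (f := cellN N)
    (fun y _ => cellN_meas N (measurableSet_singleton y))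
  simp only [Finset.coe_univ, Set.preimage_univ, Measure.restrict_apply_univ] at h
  rw [← h]
  refine Finset.sum_congr rfl fun a _ => ?_
  have hm := cellN_meas N (measurableSet_singleton a)
  rw [Measure.restrict_apply hm, Measure.restrict_apply (hm.inter hC), ← cellN_inter]
  congr 1
  ext x; simp only [Set.mem_inter_iff]; tauto

lemma phi_vol {N : ℕ} [NeZero N] (σ : Equiv.Perm (Fin N)) (B : Set ℝ) (hB : MeasurableSet B) :
    (volume.restrict I01) (phi σ ⁻¹' B) = (volume.restrict I01) B := by
  rw [restr_sum (N := N) B hB, restr_sum (N := N) _ (phi_meas σ hB),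
    ← Equiv.sum_comp σ (fun a : Fin N =>
      volume (B ∩ Set.Ioc ((a : ℕ) / (N:ℝ)) (((a : ℕ) + 1) / (N:ℝ))))]
  refine Finset.sum_congr rfl fun a _ => ?_
  rw [← measure_preimage_add_right volume ((((σ a : ℕ) : ℝ) - ((a : ℕ) : ℝ)) / N)
    (B ∩ Set.Ioc (((σ a) : ℕ) / (N:ℝ)) ((((σ a) : ℕ) + 1) / (N:ℝ)))]
  congr 1
  ext x
  simp only [Set.mem_inter_iff, Set.mem_preimage]
  have hiff : x ∈ Set.Ioc ((a : ℕ) / (N:ℝ)) (((a : ℕ) + 1) / (N:ℝ)) ↔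
      x + (((σ a : ℕ) : ℝ) - ((a : ℕ) : ℝ)) / N ∈
        Set.Ioc (((σ a) : ℕ) / (N:ℝ)) ((((σ a) : ℕ) + 1) / (N:ℝ)) := by
    simp only [Set.mem_Ioc, add_div, sub_div]
    constructor <;> rintro ⟨h1, h2⟩ <;> constructor <;> linarith
  rw [← hiff]
  refine and_congr_left fun hx => ?_
  have hx1 := Ioc_sub a hx
  rw [phi, if_pos hx1, (cellN_eq_iff hx1 a).2 hx]

lemma phi_mp {N : ℕ} [NeZero N] (σ : Equiv.Perm (Fin N)) :
    MeasurePreserving (phi σ) (volume.restrict I01) (volume.restrict I01) := by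
  refine ⟨phi_meas σ, ?_⟩
  ext B hB
  rw [Measure.map_apply (phi_meas σ) hB, phi_vol σ B hB]

/-- the invertible measure preserving map of a permutation of the grid -/
def phiMP {N : ℕ} [NeZero N] (σ : Equiv.Perm (Fin N)) : InvMP where
  toFun := phi σ
  invFun := phi σ.symm
  maps := fun x hx => phi_I01 σ hx
  mapsInv := fun x hx => phi_I01 _ hx
  measurePreserving := phi_mp σ
  measurePreservingInv := phi_mp _
  leftInv := fun x _ => phi_inv σ x
  rightInv := fun x _ => by simpa using phi_inv σ.symm x

/-- identity -/
def idMP : InvMP where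
  toFun := id
  invFun := id
  maps := fun x hx => hx
  mapsInv := fun x hx => hx
  measurePreserving := MeasurePreserving.id _
  measurePreservingInv := MeasurePreserving.id _
  leftInv := fun x _ => rfl
  rightInv := fun x _ => rfl

/-- bounded measurable kernel -/
def Good (K : ℝ → ℝ → ℝ) : Prop :=
  Measurable (Function.uncurry K) ∧ ∃ C, ∀ x y, |K x y| ≤ C

lemma Good.sub {K L : ℝ → ℝ → ℝ} (hK : Good K) (hL : Good L) :
    Good fun x y => K x y - L x y := by
  obtain ⟨hk, C, hC⟩ := hK
  obtain ⟨hl, D, hD⟩ := hL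
  exact ⟨hk.sub hl, C + D, fun x y => (abs_sub _ _).trans (add_le_add (hC x y) (hD x y))⟩

lemma Good.comp {K : ℝ → ℝ → ℝ} (hK : Good K) {f : ℝ → ℝ} (hf : Measurable f) :
    Good fun x y => K (f x) (f y) := by
  obtain ⟨hk, C, hC⟩ := hK
  exact ⟨hk.comp ((hf.comp measurable_fst).prodMk (hf.comp measurable_snd)), C,
    fun x y => hC _ _⟩

lemma Good.integrable {K : ℝ → ℝ → ℝ} (hK : Good K) (μ ν : Measure ℝ) [IsFiniteMeasure μ]
    [IsFiniteMeasure ν] : Integrable (Function.uncurry K) (μ.prod ν) := by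
  obtain ⟨hk, C, hC⟩ := hK
  exact Integrable.of_bound hk.aestronglyMeasurable C (Eventually.of_forall fun p => hC p.1 p.2)

lemma restr_sub {S : Set ℝ} (hS : S ⊆ I01) :
    volume.restrict S = (volume.restrict I01).restrict S := by
  rw [Measure.restrict_restrict_of_subset hS]

lemma l1_prod {K : ℝ → ℝ → ℝ} (hK : Good K) :
    l1Norm K = ∫ p, |K p.1 p.2| ∂((volume.restrict I01).prod (volume.restrict I01)) := by
  unfold l1Norm
  exact (integral_prod (fun p : ℝ × ℝ => |K p.1 p.2|)
    (hK.integrable (volume.restrict I01) (volume.restrict I01)).abs).symm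

lemma ae_prod : ∀ᵐ p ∂((volume.restrict I01).prod (volume.restrict I01)),
    p.1 ∈ Set.Ioc (0:ℝ) 1 ∧ p.2 ∈ Set.Ioc (0:ℝ) 1 := by
  have h1 := (Measure.quasiMeasurePreserving_fst (μ := volume.restrict I01)
    (ν := volume.restrict I01)).ae ae_Ioc
  have h2 := (Measure.quasiMeasurePreserving_snd (μ := volume.restrict I01)
    (ν := volume.restrict I01)).ae ae_Ioc
  filter_upwards [h1, h2] with p a b using ⟨a, b⟩

lemma l1_triangle {K K1 K2 : ℝ → ℝ → ℝ} (hK : Good K) (h1 : Good K1) (h2 : Good K2)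
    (h : ∀ x ∈ Set.Ioc (0:ℝ) 1, ∀ y ∈ Set.Ioc (0:ℝ) 1, |K x y| ≤ |K1 x y| + |K2 x y|) :
    l1Norm K ≤ l1Norm K1 + l1Norm K2 := by
  rw [l1_prod hK, l1_prod h1, l1_prod h2]
  have i1 := (h1.integrable (volume.restrict I01) (volume.restrict I01)).abs
  have i2 := (h2.integrable (volume.restrict I01) (volume.restrict I01)).abs
  have e := integral_add i1 i2
  refine le_trans ?_ e.le
  refine integral_mono_ae (hK.integrable (volume.restrict I01) (volume.restrict I01)).abs
    (i1.add i2) ?_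
  filter_upwards [ae_prod] with p hp using h _ hp.1 _ hp.2

lemma l1_congr {K K1 : ℝ → ℝ → ℝ}
    (h : ∀ x ∈ Set.Ioc (0:ℝ) 1, ∀ y ∈ Set.Ioc (0:ℝ) 1, |K x y| = |K1 x y|) :
    l1Norm K = l1Norm K1 := by
  unfold l1Norm
  refine integral_congr_ae ?_
  filter_upwards [ae_Ioc] with x hx
  refine integral_congr_ae ?_
  filter_upwards [ae_Ioc] with y hy using h x hx y hy

lemma l1_nonneg (K : ℝ → ℝ → ℝ) : 0 ≤ l1Norm K :=
  integral_nonneg fun _ => integral_nonneg fun _ => abs_nonneg _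

lemma l1_le_one {K : ℝ → ℝ → ℝ} (hK : Good K) (h : ∀ x y, |K x y| ≤ 1) : l1Norm K ≤ 1 := by
  rw [l1_prod hK]
  calc _ ≤ ∫ p, (1:ℝ) ∂((volume.restrict I01).prod (volume.restrict I01)) :=
        integral_mono (hK.integrable (volume.restrict I01) (volume.restrict I01)).abs
          (integrable_const _) fun p => h _ _
    _ = 1 := by simp

lemma l1_inv {K : ℝ → ℝ → ℝ} (hK : Good K) (φ : InvMP) (hφ : Measurable φ.toFun) :
    l1Norm (fun x y => K (φ.toFun x) (φ.toFun y)) = l1Norm K := by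
  rw [l1_prod hK, l1_prod (hK.comp hφ)]
  have hp := φ.measurePreserving.prod φ.measurePreserving
  have h := integral_map (μ := (volume.restrict I01).prod (volume.restrict I01))
    hp.measurable.aemeasurable (f := fun p : ℝ × ℝ => |K p.1 p.2|)
    (by exact hK.1.abs.aestronglyMeasurable)
  rw [hp.map_eq] at h
  rw [h]
  rfl

lemma l1_swap {K : ℝ → ℝ → ℝ} (hK : Good K) :
    l1Norm (fun x y => K y x) = l1Norm K := by
  have hK' : Good (fun x y => K y x) := ⟨hK.1.comp measurable_swap, hK.2.imp fun C h x y => h y x⟩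
  rw [l1_prod hK, l1_prod hK', ← integral_prod_swap]
  rfl

lemma cut_le_l1 {K : ℝ → ℝ → ℝ} (hK : Good K) {S T : Set ℝ} (hS : S ⊆ I01) (hT : T ⊆ I01) :
    |∫ x in S, ∫ y in T, K x y| ≤ l1Norm K := by
  rw [l1_prod hK, restr_sub hS, restr_sub hT]
  have := integral_prod (fun p : ℝ × ℝ => K p.1 p.2)
    (hK.integrable ((volume.restrict I01).restrict S) ((volume.restrict I01).restrict T))
  rw [← this, Measure.prod_restrict]
  refine abs_integral_le_integral_abs.trans ?_
  exact setIntegral_le_integral (hK.integrable (volume.restrict I01) (volume.restrict I01)).abs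
    (Eventually.of_forall fun p => abs_nonneg _)

lemma cut_congr {K K1 : ℝ → ℝ → ℝ} {S T : Set ℝ} (hS : S ⊆ I01) (hT : T ⊆ I01)
    (h : ∀ x ∈ Set.Ioc (0:ℝ) 1, ∀ y ∈ Set.Ioc (0:ℝ) 1, K x y = K1 x y) :
    ∫ x in S, ∫ y in T, K x y = ∫ x in S, ∫ y in T, K1 x y := by
  refine integral_congr_ae ?_
  filter_upwards [ae_restrict_of_ae_restrict_of_subset hS ae_Ioc] with x hx
  refine integral_congr_ae ?_
  filter_upwards [ae_restrict_of_ae_restrict_of_subset hT ae_Ioc] with y hy using h x hx y hy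

lemma fin_meas {S : Set ℝ} (hS : S ⊆ I01) : IsFiniteMeasure (volume.restrict S) := by
  rw [restr_sub hS]; infer_instance

lemma cut_sub {K K1 : ℝ → ℝ → ℝ} (hK : Good K) (hK1 : Good K1) {S T : Set ℝ}
    (hS : S ⊆ I01) (hT : T ⊆ I01) :
    ∫ x in S, ∫ y in T, (K x y - K1 x y) =
      (∫ x in S, ∫ y in T, K x y) - ∫ x in S, ∫ y in T, K1 x y := by
  haveI := fin_meas hS
  haveI := fin_meas hT
  have i := hK.integrable (volume.restrict S) (volume.restrict T)
  have i1 := hK1.integrable (volume.restrict S) (volume.restrict T)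
  exact integral_integral_sub i i1

/-- cell in product index form -/
def cellV (n R : ℕ) [NeZero n] [NeZero R] (x : ℝ) : Fin n × Fin R :=
  haveI : NeZero (n * R) := ⟨mul_ne_zero (NeZero.ne n) (NeZero.ne R)⟩
  finProdFinEquiv.symm (cellN (n * R) x)

lemma cellV_meas (n R : ℕ) [NeZero n] [NeZero R] : Measurable (cellV n R) := by
  haveI : NeZero (n * R) := ⟨mul_ne_zero (NeZero.ne n) (NeZero.ne R)⟩
  have h : Measurable fun k : Fin (n * R) => finProdFinEquiv.symm k := .of_discrete
  exact h.comp (cellN_meas (n * R))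

lemma step_int {V : Type*} [Fintype V] [MeasurableSpace V] [DiscreteMeasurableSpace V]
    {c : ℝ → V} (hc : Measurable c) (μ : Measure ℝ) [IsFiniteMeasure μ] (g : V → ℝ) :
    ∫ y, g (c y) ∂μ = ∑ b, μ.real (c ⁻¹' {b}) * g b := by
  have hg : Measurable g := .of_discrete
  rw [← integral_map hc.aemeasurable (f := g) hg.aestronglyMeasurable]
  haveI := Measure.isFiniteMeasure_map μ c
  rw [integral_fintype Integrable.of_finite]
  refine Finset.sum_congr rfl fun b _ => ?_
  rw [map_measureReal_apply hc (measurableSet_singleton b), smul_eq_mul]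

lemma step_int2 {V : Type*} [Fintype V] [MeasurableSpace V] [DiscreteMeasurableSpace V]
    {c : ℝ → V} (hc : Measurable c) (μ ν : Measure ℝ) [IsFiniteMeasure μ] [IsFiniteMeasure ν]
    (f : V → V → ℝ) :
    ∫ x, ∫ y, f (c x) (c y) ∂ν ∂μ =
      ∑ a, ∑ b, μ.real (c ⁻¹' {a}) * ν.real (c ⁻¹' {b}) * f a b := by
  have h : ∀ x, ∫ y, f (c x) (c y) ∂ν = ∑ b, ν.real (c ⁻¹' {b}) * f (c x) b := fun x =>
    step_int hc ν (f (c x))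
  simp_rw [h]
  rw [step_int hc μ (fun a => ∑ b, ν.real (c ⁻¹' {b}) * f a b)]
  refine Finset.sum_congr rfl fun a _ => ?_
  rw [Finset.mul_sum]
  refine Finset.sum_congr rfl fun b _ => by ring

lemma cellV_vol {n R : ℕ} [NeZero n] [NeZero R] (a : Fin n × Fin R) :
    (volume.restrict I01).real (cellV n R ⁻¹' {a}) = 1 / ((n:ℝ) * R) := by
  haveI : NeZero (n * R) := ⟨mul_ne_zero (NeZero.ne n) (NeZero.ne R)⟩
  have : cellV n R ⁻¹' {a} = cellN (n * R) ⁻¹' {finProdFinEquiv a} := by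
    ext x
    simp only [cellV, Set.mem_preimage, Set.mem_singleton_iff]
    exact Equiv.symm_apply_eq _
  rw [this, Measure.real, cellN_vol, ENNReal.toReal_ofReal (by positivity)]
  push_cast; rfl

lemma cellV_fst {n R : ℕ} [NeZero n] [NeZero R] {x : ℝ} (hx : x ∈ Set.Ioc (0:ℝ) 1) :
    (cellV n R x).1 = cellN n x := by
  haveI : NeZero (n * R) := ⟨mul_ne_zero (NeZero.ne n) (NeZero.ne R)⟩
  symm
  rw [cellN_eq_iff hx]
  have h := (cellN_eq_iff hx (cellN (n * R) x)).1 rfl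
  have e : cellN (n * R) x = finProdFinEquiv (cellV n R x) :=
    (Equiv.apply_symm_apply _ _).symm
  rw [e] at h
  generalize cellV n R x = v at h ⊢
  obtain ⟨i, s⟩ := v
  have hR0 : 0 < (R:ℝ) := by exact_mod_cast Nat.pos_of_ne_zero (NeZero.ne R)
  have hn0 : 0 < (n:ℝ) := by exact_mod_cast Nat.pos_of_ne_zero (NeZero.ne n)
  simp only [finProdFinEquiv_apply_val] at h
  push_cast at h
  have hs : ((s : ℕ) : ℝ) + 1 ≤ R := by exact_mod_cast s.2
  have hs0 : (0:ℝ) ≤ ((s : ℕ) : ℝ) := by positivity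
  rw [Set.mem_Ioc, div_lt_iff₀ (by positivity), le_div_iff₀ (by positivity)] at h ⊢
  constructor
  · by_contra hh
    push Not at hh
    nlinarith [mul_le_mul_of_nonneg_right hh hR0.le]
  · by_contra hh
    push Not at hh
    nlinarith [mul_lt_mul_of_pos_right hh hR0]

lemma graphonOf_eq {n : ℕ} [NeZero n] (G : SimpleGraph (Fin n)) [DecidableRel G.Adj]
    {x y : ℝ} (hx : x ∈ Set.Ioc (0:ℝ) 1)
    (hy : y ∈ Set.Ioc (0:ℝ) 1) :
    graphonOf G x y = if G.Adj (cellN n x) (cellN n y) then 1 else 0 := by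
  unfold graphonOf
  have : (∃ i j : Fin n, G.Adj i j ∧ x ∈ Set.Ioc (((i : ℕ) : ℝ) / n) ((((i : ℕ) : ℝ) + 1) / n)
      ∧ y ∈ Set.Ioc (((j : ℕ) : ℝ) / n) ((((j : ℕ) : ℝ) + 1) / n)) ↔
      G.Adj (cellN n x) (cellN n y) := by
    simp_rw [← cellN_eq_iff hx, ← cellN_eq_iff hy]
    constructor
    · rintro ⟨i, j, h, rfl, rfl⟩; exact h
    · intro h; exact ⟨_, _, h, rfl, rfl⟩
  simp only [this]

lemma graphonOf_good {n : ℕ} (G : SimpleGraph (Fin n)) : Good (graphonOf G) := by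
  refine ⟨?_, 1, fun x y => ?_⟩
  · unfold graphonOf Function.uncurry
    refine Measurable.ite ?_ measurable_const measurable_const
    simp only [Set.ofPred_exists]
    refine MeasurableSet.iUnion fun i => MeasurableSet.iUnion fun j => ?_
    refine (MeasurableSet.const _).inter ?_
    exact (measurable_fst measurableSet_Ioc).inter (measurable_snd measurableSet_Ioc)
  · unfold graphonOf
    split_ifs <;> norm_num

lemma step_good {n R : ℕ} [NeZero n] [NeZero R] (f : Fin n × Fin R → Fin n × Fin R → ℝ) :
    Good fun x y => f (cellV n R x) (cellV n R y) := by
  refine ⟨?_, ∑ a, ∑ b, |f a b|, fun x y => ?_⟩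
  · have h : Measurable (Function.uncurry f) := .of_discrete
    exact h.comp (((cellV_meas n R).comp measurable_fst).prodMk
      ((cellV_meas n R).comp measurable_snd))
  · refine le_trans ?_ (Finset.single_le_sum (f := fun a => ∑ b, |f a b|)
      (fun a _ => Finset.sum_nonneg fun b _ => abs_nonneg _) (Finset.mem_univ (cellV n R x)))
    exact Finset.single_le_sum (f := fun b => |f (cellV n R x) b|)
      (fun b _ => abs_nonneg _) (Finset.mem_univ (cellV n R y))

lemma l1_step {n R : ℕ} [NeZero n] [NeZero R] (f : Fin n × Fin R → Fin n × Fin R → ℝ) :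
    l1Norm (fun x y => f (cellV n R x) (cellV n R y)) =
      (∑ a, ∑ b, |f a b|) / ((n:ℝ) * R) ^ 2 := by
  unfold l1Norm
  rw [step_int2 (cellV_meas n R) (volume.restrict I01) (volume.restrict I01)
    (fun a b => |f a b|)]
  simp_rw [cellV_vol, Finset.sum_div]
  refine Finset.sum_congr rfl fun a _ => Finset.sum_congr rfl fun b _ => ?_
  ring

lemma cut_step {n R : ℕ} [NeZero n] [NeZero R] (f : Fin n × Fin R → Fin n × Fin R → ℝ) (B : ℝ)
    (hf : ∀ s t : Fin n × Fin R → ℝ, (∀ v, |s v| ≤ 1) → (∀ v, |t v| ≤ 1) →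
      |∑ x, ∑ y, s x * t y * f x y| ≤ B * ((n:ℝ) * R) ^ 2)
    {S T : Set ℝ} (hS : S ⊆ I01) (hT : T ⊆ I01) :
    |∫ x in S, ∫ y in T, f (cellV n R x) (cellV n R y)| ≤ B := by
  haveI := fin_meas hS
  haveI := fin_meas hT
  have hR0 : 0 < (R:ℝ) := by exact_mod_cast Nat.pos_of_ne_zero (NeZero.ne R)
  have hn0 : 0 < (n:ℝ) := by exact_mod_cast Nat.pos_of_ne_zero (NeZero.ne n)
  rw [step_int2 (cellV_meas n R)]
  have hb : ∀ S : Set ℝ, S ⊆ I01 → ∀ v,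
      |((n:ℝ) * R) * (volume.restrict S).real (cellV n R ⁻¹' {v})| ≤ 1 := by
    intro S hS v
    have h1 : (volume.restrict S).real (cellV n R ⁻¹' {v}) ≤ 1 / ((n:ℝ) * R) := by
      rw [← cellV_vol v]
      exact ENNReal.toReal_mono (measure_ne_top _ _) (Measure.restrict_mono hS le_rfl _)
    rw [abs_of_nonneg (by positivity)]
    rw [le_div_iff₀ (by positivity)] at h1
    linarith
  have h := hf _ _ (hb S hS) (hb T hT)
  have e : ∑ x, ∑ y, ((n:ℝ) * R) * (volume.restrict S).real (cellV n R ⁻¹' {x}) *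
      (((n:ℝ) * R) * (volume.restrict T).real (cellV n R ⁻¹' {y})) * f x y =
      (∑ x, ∑ y, (volume.restrict S).real (cellV n R ⁻¹' {x}) *
      (volume.restrict T).real (cellV n R ⁻¹' {y}) * f x y) * ((n:ℝ) * R) ^ 2 := by
    simp_rw [Finset.sum_mul]
    refine Finset.sum_congr rfl fun a _ => Finset.sum_congr rfl fun b _ => ?_
    ring
  rw [e, abs_mul, abs_of_pos (show 0 < ((n:ℝ) * R) ^ 2 by positivity)] at h
  exact le_of_mul_le_mul_right h (by positivity)

lemma deltaCut_le (U W : ℝ → ℝ → ℝ) (φ : InvMP) (B : ℝ) (hB : 0 ≤ B)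
    (h : ∀ S T : Set ℝ, MeasurableSet S → MeasurableSet T → S ⊆ I01 → T ⊆ I01 →
      |∫ x in S, ∫ y in T, (U x y - W (φ.toFun x) (φ.toFun y))| ≤ B) :
    deltaCut U W ≤ B := by
  unfold deltaCut
  refine (ciInf_le ⟨0, ?_⟩ φ).trans ?_
  · rintro _ ⟨ψ, rfl⟩
    apply Real.sSup_nonneg
    rintro _ ⟨S, T, -, -, -, -, rfl⟩
    exact abs_nonneg _
  · apply Real.sSup_le _ hB
    rintro _ ⟨S, T, h1, h2, h3, h4, rfl⟩
    exact h S T h1 h2 h3 h4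

/-- truncation to the unit interval -/
def clp (z : ℝ) : ℝ := max 0 (min 1 z)

lemma clp_mem (z : ℝ) : clp z ∈ Set.Icc (0:ℝ) 1 :=
  ⟨le_max_left _ _, max_le zero_le_one (min_le_left _ _)⟩

lemma clp_close {a z : ℝ} (ha : a ∈ Set.Icc (0:ℝ) 1) : |a - clp z| ≤ |a - z| := by
  unfold clp
  have h1 := ha.1
  have h2 := ha.2
  rcases max_cases 0 (min 1 z) with ⟨h, h'⟩ | ⟨h, h'⟩ <;>
  rcases min_cases 1 z with ⟨h3, h3'⟩ | ⟨h3, h3'⟩ <;> rw [h] <;>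
  simp only [h3] at * <;> rw [abs_le] <;> 
  constructor <;> cases abs_cases (a - z) <;> linarith

lemma IsGraphon.good {U : ℝ → ℝ → ℝ} (hU : IsGraphon U) : Good U :=
  ⟨hU.1, 1, fun x y => by rw [abs_of_nonneg (hU.2.2 x y).1]; exact (hU.2.2 x y).2⟩

lemma approx {U : ℝ → ℝ → ℝ} (hU : IsGraphon U) (n : ℕ) [NeZero n] (η : ℝ) (hη : 0 < η) :
    ∃ (R : ℕ) (_ : NeZero R) (u : Fin n × Fin R → Fin n × Fin R → ℝ),
      (∀ x y, u x y = u y x) ∧ (∀ x y, u x y ∈ Set.Icc (0:ℝ) 1) ∧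
      l1Norm (fun x y => U x y - u (cellV n R x) (cellV n R y)) ≤ η := by
  have hUg := IsGraphon.good hU
  have hn0 : 0 < (n:ℝ) := by exact_mod_cast Nat.pos_of_ne_zero (NeZero.ne n)
  set μ := (volume.restrict I01).prod (volume.restrict I01) with hμ
  have hUi : Integrable (Function.uncurry U) μ := hUg.integrable _ _
  obtain ⟨g, gs, gint, gc, gi⟩ := hUi.exists_hasCompactSupport_integral_sub_le
    (half_pos hη)
  have guc := gs.uniformContinuous_of_continuous gc
  obtain ⟨δ, hδ, hgδ⟩ := Metric.uniformContinuous_iff.1 guc (η / 2) (half_pos hη)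
  obtain ⟨R', hR'⟩ := exists_nat_gt (1 / δ)
  let R := R' + 1
  have hRne : NeZero R := ⟨Nat.succ_ne_zero _⟩
  have hR0 : 0 < (R:ℝ) := by exact_mod_cast Nat.pos_of_ne_zero (NeZero.ne R)
  haveI hNne : NeZero (n * R) := ⟨mul_ne_zero (NeZero.ne n) (NeZero.ne R)⟩
  have hNδ : 1 / ((n:ℝ) * R) < δ := by
    have h1 : (1:ℝ) ≤ n := by exact_mod_cast Nat.pos_of_ne_zero (NeZero.ne n)
    have h2 : 1 / δ < R := by
      have : (R:ℝ) = R' + 1 := by simp [R]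
      linarith
    rw [div_lt_iff₀ hδ] at h2
    rw [div_lt_iff₀ (by positivity)]
    nlinarith [mul_le_mul_of_nonneg_right h1 (by positivity : 0 ≤ (R:ℝ) * δ)]
  let pt : Fin n × Fin R → ℝ := fun v => (((finProdFinEquiv v : Fin (n * R)) : ℕ) + 1) / ((n:ℝ) * R)
  have hpt : ∀ x ∈ Set.Ioc (0:ℝ) 1, |x - pt (cellV n R x)| < δ := by
    intro x hx
    have h := (cellN_eq_iff hx (cellN (n * R) x)).1 rfl
    have e : cellN (n * R) x = finProdFinEquiv (cellV n R x) :=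
      (Equiv.apply_symm_apply _ _).symm
    rw [e] at h
    push_cast at h
    have hp : pt (cellV n R x) = (((finProdFinEquiv (cellV n R x) : Fin (n * R)) : ℕ) : ℝ) / ((n:ℝ) * R)
      + 1 / ((n:ℝ) * R) := by simp only [pt]; rw [add_div]
    have h1 := h.1
    have h2 := h.2
    rw [add_div] at h2
    rw [hp, abs_lt]
    constructor <;> linarith
  let h : ℝ → ℝ → ℝ := fun x y => (g (x, y) + g (y, x)) / 2
  let u : Fin n × Fin R → Fin n × Fin R → ℝ := fun a b => clp (h (pt a) (pt b))
  refine ⟨R, hRne, u, fun x y => ?_, fun x y => clp_mem _, ?_⟩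
  · simp only [u, h]; rw [add_comm]
  have hg1 : Integrable (fun p : ℝ × ℝ => |U p.1 p.2 - g p|) μ := (hUi.sub gi).abs
  have hg2 : Integrable (fun p : ℝ × ℝ => |U p.2 p.1 - g (p.2, p.1)|) μ := hg1.swap
  have hsw : ∫ p, |U p.2 p.1 - g (p.2, p.1)| ∂μ = ∫ p, |U p.1 p.2 - g p| ∂μ := 
    integral_prod_swap (fun p : ℝ × ℝ => |U p.1 p.2 - g p|)
  have gint' : ∫ p, |U p.1 p.2 - g p| ∂μ ≤ η / 2 := gint
  rw [l1_prod (hUg.sub (step_good u))]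
  calc _ ≤ ∫ p, ((|U p.1 p.2 - g p| + |U p.2 p.1 - g (p.2, p.1)|) / 2 + η / 2) ∂μ := by
        refine integral_mono_ae ((hUg.sub (step_good u)).integrable _ _).abs
          (((hg1.add hg2).div_const 2).add (integrable_const _)) ?_
        filter_upwards [ae_prod] with p hp
        obtain ⟨x, y⟩ := p
        have hx := hpt x hp.1
        have hy := hpt y hp.2
        simp only at hx hy ⊢
        have d1 := hgδ (a := (x, y)) (b := (pt (cellV n R x), pt (cellV n R y))) (by
          rw [Prod.dist_eq]; exact max_lt hx hy)
        have d2 := hgδ (a := (y, x)) (b := (pt (cellV n R y), pt (cellV n R x))) (by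
          rw [Prod.dist_eq]; exact max_lt hy hx)
        rw [Real.dist_eq, abs_lt] at d1 d2
        refine (clp_close (hU.2.2 x y)).trans ?_
        simp only [h]
        have hs := hU.2.1 x y
        have a1 := abs_le.1 (le_refl |U x y - g (x, y)|)
        have a2 := abs_le.1 (le_refl |U y x - g (y, x)|)
        rw [abs_le]
        constructor <;> linarith [a1.1, a1.2, a2.1, a2.2, d1.1, d1.2, d2.1, d2.2]
    _ = (∫ p, |U p.1 p.2 - g p| ∂μ) + η / 2 := by
        have i12 : Integrable (fun p : ℝ × ℝ =>
          (|U p.1 p.2 - g p| + |U p.2 p.1 - g (p.2, p.1)|) / 2) μ := (hg1.add hg2).div_const 2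
        rw [integral_add i12 (integrable_const _), integral_div,
          integral_add hg1 hg2, hsw]
        simp
    _ ≤ η := by linarith

lemma X1_eq_sum {n R : ℕ} (u : Fin n × Fin R → Fin n × Fin R → ℝ) (A : Fin n → Fin n → ℝ) :
    ∑ a : Fin n × Fin R, ∑ b : Fin n × Fin R, |A a.1 b.1 - u a b| = X1 u A := by
  unfold X1
  simp_rw [Fintype.sum_prod_type]
  refine Finset.sum_congr rfl fun i _ => ?_
  rw [Finset.sum_comm]

lemma l1_graph {n R : ℕ} [NeZero n] [NeZero R] (u : Fin n × Fin R → Fin n × Fin R → ℝ)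
    (G : SimpleGraph (Fin n)) (A : Fin n → Fin n → ℝ) [DecidableRel G.Adj]
    (hA : ∀ i j, A i j = if G.Adj i j then 1 else 0) :
    l1Norm (fun x y => graphonOf G x y - u (cellV n R x) (cellV n R y)) =
      X1 u A / ((n:ℝ) * R) ^ 2 := by
  rw [← X1_eq_sum, ← l1_step (fun a b => A a.1 b.1 - u a b)]
  refine l1_congr fun x hx y hy => ?_
  rw [graphonOf_eq G hx hy, cellV_fst hx, cellV_fst hy, hA]

lemma params (n : ℕ) (L : ℝ) (hL : Real.log (Real.log n) = L) (hL2 : 2500 < L) :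
    ∃ m : ℕ, 1 < m * ((9 / Real.sqrt L) ^ 4) ^ 2 ∧ 12 ≤ (9 / Real.sqrt L) ^ 4 * n ∧
      12 * (4:ℝ) ^ m ≤ (9 / Real.sqrt L) ^ 2 * n := by
  have hL0 : 0 < L := by linarith
  have hlog : 0 < Real.log n := by
    by_contra h
    push Not at h
    have h0 : 0 ≤ Real.log n := Real.log_natCast_nonneg n
    have : Real.log n = 0 := le_antisymm h h0
    rw [this, Real.log_zero] at hL
    linarith
  have hn0 : 0 < (n:ℝ) := by
    rcases Nat.eq_zero_or_pos n with h | h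
    · subst h; simp at hlog
    · exact_mod_cast h
  have hn : (n:ℝ) = Real.exp (Real.exp L) := by
    rw [← hL, Real.exp_log hlog, Real.exp_log hn0]
  have hE := Real.pow_div_factorial_le_exp L hL0.le 4
  have hE2 := Real.pow_div_factorial_le_exp L hL0.le 2
  have hLE := Real.add_one_le_exp L
  have hEE := Real.add_one_le_exp (Real.exp L)
  norm_num [Nat.factorial] at hE hE2
  have e2 : (9 / Real.sqrt L) ^ 2 = 81 / L := by
    rw [div_pow, Real.sq_sqrt hL0.le]; norm_num
  have e4 : (9 / Real.sqrt L) ^ 4 = 6561 / L ^ 2 := by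
    have : (9 / Real.sqrt L) ^ 4 = ((9 / Real.sqrt L) ^ 2) ^ 2 := by ring
    rw [this, e2, div_pow]; norm_num
  rw [e2, e4]
  refine ⟨⌈L ^ 4 / 43046721⌉₊ + 1, ?_, ?_, ?_⟩
  · have := Nat.le_ceil (L ^ 4 / 43046721)
    push_cast
    have e : (6561 / L ^ 2) ^ 2 = 43046721 / L ^ 4 := by rw [div_pow]; ring
    rw [e, ← mul_div_assoc, lt_div_iff₀ (by positivity)]
    linarith
  · rw [div_mul_eq_mul_div, le_div_iff₀ (by positivity), hn]
    linarith
  · have hm := Nat.ceil_lt_add_one (show 0 ≤ L ^ 4 / 43046721 by positivity)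
    set m := ⌈L ^ 4 / 43046721⌉₊ + 1 with hmd
    have hm2 : (m:ℝ) ≤ L ^ 4 / 43046721 + 2 := by rw [hmd]; push_cast; linarith
    have he : (2.7:ℝ) ≤ Real.exp 1 := by linarith [Real.exp_one_gt_d9]
    have h4 : (4:ℝ) ≤ Real.exp 2 := by
      have : Real.exp 2 = Real.exp 1 * Real.exp 1 := by rw [← Real.exp_add]; norm_num
      rw [this]; nlinarith
    have h12 : (12:ℝ) ≤ Real.exp 3 := by
      have : Real.exp 3 = Real.exp 1 * Real.exp 2 := by rw [← Real.exp_add]; norm_num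
      have h2 : Real.exp 2 = Real.exp 1 * Real.exp 1 := by rw [← Real.exp_add]; norm_num
      have h7 : (7.29:ℝ) ≤ Real.exp 2 := by rw [h2]; nlinarith
      rw [this]; nlinarith
    have h4m : (4:ℝ) ^ m ≤ Real.exp (m * 2) := by
      rw [Real.exp_nat_mul]; gcongr
    rw [div_mul_eq_mul_div, le_div_iff₀ hL0]
    have hbig : 3 + m * 2 + L ≤ Real.exp L := by
      have h1 : L * 2500 ≤ L ^ 2 := by nlinarith
      have h2 : L ^ 2 * 2500 ≤ L ^ 3 := by nlinarith [sq_nonneg L]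
      have h3 : L ^ 3 * 2500 ≤ L ^ 4 := by nlinarith [pow_pos hL0 3]
      linarith
    calc 12 * (4:ℝ) ^ m * L ≤ Real.exp 3 * Real.exp (m * 2) * Real.exp L := by
          gcongr; linarith
      _ = Real.exp (3 + m * 2 + L) := by rw [Real.exp_add, Real.exp_add]
      _ ≤ Real.exp (Real.exp L) := Real.exp_le_exp.2 hbig
      _ ≤ 81 * n := by rw [← hn]; linarith

lemma cellV_phi {n R : ℕ} [NeZero n] [NeZero R] [NeZero (n * R)]
    (σ : Equiv.Perm (Fin n × Fin R)) {x : ℝ}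
    (hx : x ∈ Set.Ioc (0:ℝ) 1) :
    cellV n R (phi (finProdFinEquiv.symm.trans (σ.trans finProdFinEquiv) :
      Equiv.Perm (Fin (n * R))) x) = σ (cellV n R x) := by
  have e : ∀ z, cellV n R z = finProdFinEquiv.symm (cellN (n * R) z) := fun z => rfl
  rw [e, phi_cell _ hx, e]
  simp only [Equiv.trans_apply, Equiv.symm_apply_apply]

lemma main_thm
    (n : ℕ) (hn : 16 ≤ n) (G : SimpleGraph (Fin n))
    (U : ℝ → ℝ → ℝ) (hU : IsGraphon U) :
    ∃ G' : SimpleGraph (Fin n),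
      l1Norm (fun x y => graphonOf G' x y - U x y) ≤
        4 * l1Norm (fun x y => graphonOf G x y - U x y) ∧
      deltaCut (graphonOf G') U ≤ 50 / Real.sqrt (Real.log (Real.log n)) := by
  classical
  haveI : NeZero n := ⟨by omega⟩
  have hUg := IsGraphon.good hU
  set a := l1Norm (fun x y => graphonOf G x y - U x y) with ha
  set L := Real.log (Real.log n) with hL
  have hb0 : 0 ≤ 50 / Real.sqrt L := by positivity
  by_cases hab : a ≤ 50 / Real.sqrt L
  · refine ⟨G, by linarith [l1_nonneg (fun x y => graphonOf G x y - U x y)], ?_⟩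
    refine deltaCut_le _ _ idMP _ hb0 fun S T _ _ hS hT => ?_
    exact (cut_le_l1 ((graphonOf_good G).sub hUg) hS hT).trans hab
  push Not at hab
  have ha1 : a ≤ 1 := by
    refine l1_le_one ((graphonOf_good G).sub hUg) fun x y => ?_
    have h1 : graphonOf G x y ∈ Set.Icc (0:ℝ) 1 := by
      unfold graphonOf; split_ifs <;> simp
    have h2 := hU.2.2 x y
    rw [abs_le]; constructor <;> linarith [h1.1, h1.2, h2.1, h2.2]
  have hL0 : 0 < L := by
    have h16 : (16:ℝ) ≤ n := by exact_mod_cast hn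
    apply Real.log_pos
    rw [Real.lt_log_iff_exp_lt (by linarith)]
    linarith [Real.exp_one_lt_d9]
  have hs0 : 0 < Real.sqrt L := Real.sqrt_pos.2 hL0
  have hs50 : 50 < Real.sqrt L := by
    have := hab.trans_le ha1
    rwa [div_lt_one hs0] at this
  have hL2 : 2500 < L := by
    have := Real.sq_sqrt hL0.le
    nlinarith
  have ha0 : 0 < a := hb0.trans_lt hab
  obtain ⟨m, hm1, hm2, hm3⟩ := params n L rfl hL2
  set ε := 9 / Real.sqrt L with hε
  have hε0 : 0 < ε := by positivity
  set η := min (a / 8) (5 / Real.sqrt L) with hη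
  have hη0 : 0 < η := by rw [hη]; positivity
  have hη1 : η ≤ a / 8 := min_le_left _ _
  have hη2 : η ≤ 5 / Real.sqrt L := min_le_right _ _
  obtain ⟨R, hR, u, usym, u01, hu⟩ := approx hU n η hη0
  have hR0 : 0 < (R:ℝ) := by exact_mod_cast Nat.pos_of_ne_zero (NeZero.ne R)
  have hn0 : 0 < (n:ℝ) := by exact_mod_cast Nat.pos_of_ne_zero (NeZero.ne n)
  haveI : NeZero (n * R) := ⟨mul_ne_zero (NeZero.ne n) (NeZero.ne R)⟩
  let A0 : Fin n → Fin n → ℝ := fun i j => if G.Adj i j then 1 else 0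
  have hG := l1_graph u G A0 (fun i j => rfl)
  have hug := step_good u
  have hGu : Good (fun x y => graphonOf G x y - u (cellV n R x) (cellV n R y)) :=
    (graphonOf_good G).sub hug
  have hUu : Good (fun x y => U x y - u (cellV n R x) (cellV n R y)) := hUg.sub hug
  have hGU : Good (fun x y => graphonOf G x y - U x y) := (graphonOf_good G).sub hUg
  have t1 : a ≤ X1 u A0 / ((n:ℝ) * R) ^ 2 + η := by
    refine (l1_triangle hGU hGu hUu fun x _ y _ => ?_).trans (by rw [hG]; linarith)
    rw [abs_sub_comm (U x y)]; exact abs_sub_le _ _ _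
  have t2 : X1 u A0 / ((n:ℝ) * R) ^ 2 ≤ a + η := by
    rw [← hG]
    refine (l1_triangle hGu hGU hUu fun x _ y _ => ?_).trans (by linarith)
    exact abs_sub_le _ _ _
  have hX : 0 < X1 u A0 := by
    have : 0 < X1 u A0 / ((n:ℝ) * R) ^ 2 := by linarith
    by_contra h
    push Not at h
    exact absurd this (not_lt.2 (div_nonpos_of_nonpos_of_nonneg h (by positivity)))
  obtain ⟨A, σ, hA01, hAs, hAd, hXA, hcut⟩ := finite_main u usym u01 ε hε0 m hm1 hm2 hm3 A0
    (fun i j => by simp only [A0]; split_ifs <;> simp) (fun i => by simp [A0]) hX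
  let G' : SimpleGraph (Fin n) :=
    { Adj := fun i j => A i j = 1
      symm := ⟨fun i j h => by rw [← hAs]; exact h⟩
      loopless := ⟨fun i h => by rw [hAd] at h; exact zero_ne_one h⟩ }
  have hA' : ∀ i j, A i j = if G'.Adj i j then 1 else 0 := by
    intro i j
    change A i j = if A i j = 1 then 1 else 0
    rcases hA01 i j with h | h <;> simp [h]
  have hG' := l1_graph u G' A hA'
  have hGu' : Good (fun x y => graphonOf G' x y - u (cellV n R x) (cellV n R y)) :=
    (graphonOf_good G').sub hug
  have hGU' : Good (fun x y => graphonOf G' x y - U x y) := (graphonOf_good G').sub hUg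
  refine ⟨G', ?_, ?_⟩
  · refine (l1_triangle hGU' hGu' hUu fun x _ y _ => ?_).trans ?_
    · rw [abs_sub_comm (U x y)]; exact abs_sub_le _ _ _
    · rw [hG']
      have : X1 u A / ((n:ℝ) * R) ^ 2 ≤ 3 * (X1 u A0 / ((n:ℝ) * R) ^ 2) := by
        rw [← mul_div_assoc]; gcongr
      linarith
  · let τ : Equiv.Perm (Fin (n * R)) := finProdFinEquiv.symm.trans (σ.trans finProdFinEquiv)
    refine deltaCut_le _ _ (phiMP τ) _ hb0 fun S T _ _ hS hT => ?_
    have hφm : Measurable (phiMP τ).toFun := phi_meas τ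
    have g1 : Good (fun x y => graphonOf G' x y -
        u (cellV n R ((phiMP τ).toFun x)) (cellV n R ((phiMP τ).toFun y))) :=
      (graphonOf_good G').sub (hug.comp hφm)
    have g2 : Good (fun x y => U ((phiMP τ).toFun x) ((phiMP τ).toFun y) -
        u (cellV n R ((phiMP τ).toFun x)) (cellV n R ((phiMP τ).toFun y))) :=
      hUu.comp hφm
    have e := cut_sub g1 g2 hS hT
    simp only [sub_sub_sub_cancel_right] at e
    rw [e]
    refine (abs_sub _ _).trans ?_
    have c2 := (cut_le_l1 g2 hS hT).trans ((l1_inv hUu (phiMP τ) hφm).le.trans hu)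
    have c1 : |∫ x in S, ∫ y in T, (graphonOf G' x y -
        u (cellV n R ((phiMP τ).toFun x)) (cellV n R ((phiMP τ).toFun y)))| ≤ 5 * ε := by
      rw [cut_congr hS hT (K1 := fun x y => (fun v w => A v.1 w.1 - u (σ v) (σ w))
        (cellV n R x) (cellV n R y)) (fun x hx y hy => ?_)]
      · exact cut_step (fun v w => A v.1 w.1 - u (σ v) (σ w)) (5 * ε) hcut hS hT
      · have ex : cellV n R ((phiMP τ).toFun x) = σ (cellV n R x) := cellV_phi σ hx
        have ey : cellV n R ((phiMP τ).toFun y) = σ (cellV n R y) := cellV_phi σ hy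
        rw [ex, ey, graphonOf_eq G' hx hy]
        simp only
        rw [cellV_fst hx, cellV_fst hy]
        exact congrArg (fun z => z - u (σ (cellV n R x)) (σ (cellV n R y))) (hA' _ _).symm
    have e5 : 5 * ε + 5 / Real.sqrt L = 50 / Real.sqrt L := by rw [hε]; ring
    linarith

end SampleAux

theorem exists_graph_close_in_l1_and_cut
    (n : ℕ) (hn : 16 ≤ n) (G : SimpleGraph (Fin n))
    (U : ℝ → ℝ → ℝ) (hU : IsGraphon U) :
    ∃ G' : SimpleGraph (Fin n),
      l1Norm (fun x y => graphonOf G' x y - U x y) ≤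
        4 * l1Norm (fun x y => graphonOf G x y - U x y) ∧
      deltaCut (graphonOf G') U ≤ 50 / Real.sqrt (Real.log (Real.log n)) := by
  exact SampleAux.main_thm n hn G U hU

end
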